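/- arXiv:0708.2321 — 2 statements merged into one kernel-verified Lean document; each statement's English description precedes it below -/
import Mathlib

section
/- Let d ≥ 1 be an integer and let L, β, α be positive constants such that αβ ≤ d. Then there exists a constant C > 0 such that for every n ≥ 1 and every classifier f̂_n: 𝒵^n → ℱ, sup_{P∈𝒫_Σ} {E[R(f̂_n)] − R(f*)} ≥ C n^{−β(1+α)/(2β+d)}. -/
open MeasureTheory ENNReal Matrix
open scoped Classical

noncomputable section

abbrev Euc (d : ℕ) := EuclideanSpace ℝ (Fin d)

/-- Margin (low noise) assumption (MA) with parameters `α`, `C₀`: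
`P_X(0 < |η(X) − 1/2| ≤ t) ≤ C₀ t^α` for all `t > 0`. -/
def margin (d : ℕ) (α C₀ : ℝ) (PX : Measure (Euc d)) (η : Euc d → ℝ) : Prop :=
  ∀ t : ℝ, 0 < t →
    PX {x | 0 < |η x - 1/2| ∧ |η x - 1/2| ≤ t} ≤ ENNReal.ofReal (C₀ * t ^ α)

/-- The plug-in rule `1{η ≥ 1/2}`; applied to the true regression function this is
the Bayes rule `f*`. -/
def plugin (d : ℕ) (η : Euc d → ℝ) : Euc d → Bool :=
  fun x => if 1/2 ≤ η x then true else false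

/-- Excess risk `R(f) − R(f*) = E[|2η(X)−1| 1{f(X) ≠ f*(X)}]`. -/
def excessRisk (d : ℕ) (PX : Measure (Euc d)) (η : Euc d → ℝ) (f : Euc d → Bool) : ℝ :=
  ∫ x, (if f x = plugin d η x then 0 else |2 * η x - 1|) ∂PX

/-- Joint distribution `P` of `(X,Y)` on `ℝ^d × ℝ` (with `Y ∈ {0,1}`) determined by the
marginal `PX` of `X` and the regression function `η(x) = P(Y = 1 | X = x)`. -/
def joint (d : ℕ) (PX : Measure (Euc d)) (η : Euc d → ℝ) : Measure (Euc d × ℝ) :=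
  PX.bind fun x =>
    ENNReal.ofReal (η x) • Measure.dirac (x, (1:ℝ)) +
      ENNReal.ofReal (1 - η x) • Measure.dirac (x, (0:ℝ))

/-- Law `P^⊗n` of the i.i.d. sample `(X₁,Y₁),…,(Xₙ,Yₙ)`. -/
def sampleLaw (d n : ℕ) (PX : Measure (Euc d)) (η : Euc d → ℝ) :
    Measure (Fin n → Euc d × ℝ) :=
  Measure.pi fun _ => joint d PX η

/-- Expected excess risk `E[R(f̂ₙ)] − R(f*)` of a classifier `f̂ₙ`. -/
def expectedExcess (d n : ℕ) (PX : Measure (Euc d)) (η : Euc d → ℝ)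
    (fhat : (Fin n → Euc d × ℝ) → Euc d → Bool) : ℝ :=
  ∫ D, excessRisk d PX η (fhat D) ∂(sampleLaw d n PX η)

/-- Multivariate Taylor polynomial of degree `k` of `g` at `x`, evaluated at `x'`. -/
def taylorPoly (d : ℕ) (k : ℕ) (g : Euc d → ℝ) (x x' : Euc d) : ℝ :=
  ∑ j ∈ Finset.range (k + 1),
    ((j.factorial : ℝ))⁻¹ * iteratedFDeriv ℝ j g x (fun _ => x' - x)

/-- The Hölder class `Σ(β, L, ℝ^d)`: `⌊β⌋ = ⌈β⌉₊ - 1` times continuously differentiable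
functions whose Taylor polynomial of degree `⌊β⌋` approximates them to order `‖x' - x‖^β`. -/
def holderClass (d : ℕ) (β L : ℝ) : Set (Euc d → ℝ) :=
  {g | ContDiff ℝ (⌈β⌉₊ - 1 : ℕ) g ∧
    ∀ x x' : Euc d, |g x' - taylorPoly d (⌈β⌉₊ - 1) g x x'| ≤ L * ‖x' - x‖ ^ β}

/-- `(c₀, r₀)`-regularity of a set `A`:
`λ[A ∩ B(x,r)] ≥ c₀ λ[B(x,r)]` for all `0 < r ≤ r₀`, `x ∈ A`. -/
def regularSet (d : ℕ) (c₀ r₀ : ℝ) (A : Set (Euc d)) : Prop :=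
  ∀ x ∈ A, ∀ r : ℝ, 0 < r → r ≤ r₀ →
    ENNReal.ofReal c₀ * volume (Metric.closedBall x r) ≤ volume (A ∩ Metric.closedBall x r)

/-- Strong density assumption: `P_X` is supported on a compact `(c₀,r₀)`-regular set
`A ⊆ 𝒞` and has a Lebesgue density bounded between `μmin` and `μmax` on `A`, zero outside. -/
def strongDensity (d : ℕ) (c₀ r₀ μmin μmax : ℝ) (𝒞 : Set (Euc d))
    (PX : Measure (Euc d)) : Prop :=
  ∃ A : Set (Euc d), IsCompact A ∧ A ⊆ 𝒞 ∧ regularSet d c₀ r₀ A ∧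
    ∃ μf : Euc d → ℝ, (∀ x ∈ A, μmin ≤ μf x ∧ μf x ≤ μmax) ∧ (∀ x ∉ A, μf x = 0) ∧
      PX = volume.withDensity fun x => ENNReal.ofReal (μf x)

/-! ### Hölder classes -/

section HolderClass

variable {E : Type*} [NormedAddCommGroup E] [NormedSpace ℝ E]

lemma iteratedDeriv_comp_line {g : E → ℝ} {n : ℕ} (hg : ContDiff ℝ n g) (x v : E) (t : ℝ) :
    iteratedDeriv n (fun t : ℝ => g (x + t • v)) t =
      iteratedFDeriv ℝ n g (x + t • v) fun _ => v := by
  have h1 : (fun t : ℝ => g (x + t • v)) =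
      (fun y => g (x + y)) ∘ ((1 : ℝ →L[ℝ] ℝ).smulRight v) := by
    ext t; simp
  have h2 : ContDiff ℝ n (fun y => g (x + y)) := hg.comp (contDiff_const.add contDiff_id)
  rw [iteratedDeriv_eq_iteratedFDeriv, h1,
    ContinuousLinearMap.iteratedFDeriv_comp_right _ h2 _ le_rfl, iteratedFDeriv_comp_add_left]
  simp

lemma abs_sub_taylorPoly_le {d k : ℕ} {g : Euc d → ℝ} {L s : ℝ} (hL : 0 ≤ L) (hs : 0 ≤ s)
    (hg : ContDiff ℝ k g)
    (h : ∀ x y, ‖iteratedFDeriv ℝ k g y - iteratedFDeriv ℝ k g x‖ ≤ L * ‖y - x‖ ^ s)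
    (x x' : Euc d) : |g x' - taylorPoly d k g x x'| ≤ L * (‖x' - x‖ ^ s * ‖x' - x‖ ^ k) := by
  have key : ∃ t ∈ Set.Icc (0 : ℝ) 1, g x' - taylorPoly d k g x x' = ((k.factorial : ℝ))⁻¹ *
      (iteratedFDeriv ℝ k g (x + t • (x' - x)) - iteratedFDeriv ℝ k g x) (fun _ => x' - x) := by
    rcases k with _ | k
    · exact ⟨1, by simp, by simp [taylorPoly]⟩
    · have hline (j : ℕ) (hj : j ≤ k + 1) (t : ℝ) := iteratedDeriv_comp_line (n := j)
        (hg.of_le (by exact_mod_cast hj)) x (x' - x) t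
      have hf : ContDiff ℝ (k + 1 : ℕ) (fun t : ℝ => g (x + t • (x' - x))) :=
        hg.comp (contDiff_const.add (contDiff_id.smul contDiff_const))
      obtain ⟨t, ht, hrem⟩ := taylor_mean_remainder_lagrange_iteratedDeriv (n := k)
        (zero_ne_one (α := ℝ)) hf.contDiffOn
      refine ⟨t, ?_, ?_⟩
      · rw [Set.uIoo_of_le zero_le_one] at ht
        exact ⟨ht.1.le, ht.2.le⟩
      · have htay : taylorWithinEval (fun t : ℝ => g (x + t • (x' - x))) k (Set.uIcc 0 1) 0 1 =
            ∑ j ∈ Finset.range (k + 1),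
              ((j.factorial : ℝ))⁻¹ * iteratedFDeriv ℝ j g x (fun _ => x' - x) := by
          rw [taylor_within_apply]
          refine Finset.sum_congr rfl fun j hj => ?_
          have hj' : j ≤ k + 1 := by have := Finset.mem_range.1 hj; omega
          rw [iteratedDerivWithin_eq_iteratedDeriv (uniqueDiffOn_uIcc zero_ne_one)
            ((hf.of_le (by exact_mod_cast hj')).contDiffAt) (by simp), hline j hj']
          simp
        rw [htay, hline _ le_rfl] at hrem
        rw [taylorPoly, Finset.sum_range_succ, ← sub_sub]
        simp only [one_smul, add_sub_cancel, sub_zero, one_pow, mul_one] at hrem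
        rw [hrem]
        simp [div_eq_inv_mul, mul_sub]
  obtain ⟨t, ht, heq⟩ := key
  rw [heq, abs_mul, abs_inv, Nat.abs_cast]
  have h1 : ((k.factorial : ℝ))⁻¹ ≤ 1 :=
    inv_le_one_of_one_le₀ (by exact_mod_cast Nat.one_le_iff_ne_zero.2 k.factorial_ne_zero)
  have h2 : |(iteratedFDeriv ℝ k g (x + t • (x' - x)) - iteratedFDeriv ℝ k g x)
      (fun _ => x' - x)| ≤ L * ‖x' - x‖ ^ s * ‖x' - x‖ ^ k := by
    refine (ContinuousMultilinearMap.le_opNorm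
      (iteratedFDeriv ℝ k g (x + t • (x' - x)) - iteratedFDeriv ℝ k g x)
      (fun _ => x' - x)).trans ?_
    rw [Fin.prod_const]
    gcongr
    refine (h _ _).trans ?_
    rw [add_sub_cancel_left, norm_smul, Real.norm_of_nonneg ht.1]
    gcongr
    · exact mul_nonneg ht.1 (norm_nonneg _)
    · exact mul_le_of_le_one_left (norm_nonneg _) ht.2
  calc _ ≤ 1 * (L * ‖x' - x‖ ^ s * ‖x' - x‖ ^ k) := by gcongr
    _ = _ := by ring

lemma mem_holderClass_of_holder_iteratedFDeriv {d : ℕ} {β L : ℝ} {g : Euc d → ℝ} (hβ : 0 < β)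
    (hL : 0 ≤ L) (hg : ContDiff ℝ (⌈β⌉₊ - 1 : ℕ) g)
    (h : ∀ x y, ‖iteratedFDeriv ℝ (⌈β⌉₊ - 1) g y - iteratedFDeriv ℝ (⌈β⌉₊ - 1) g x‖ ≤
      L * ‖y - x‖ ^ (β - (⌈β⌉₊ - 1 : ℕ))) :
    g ∈ holderClass d β L := by
  have hpos : 0 < ⌈β⌉₊ := Nat.ceil_pos.2 hβ
  have hlt : ((⌈β⌉₊ - 1 : ℕ) : ℝ) < β := Nat.lt_ceil.1 (by omega)
  refine ⟨hg, fun x x' => ?_⟩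
  refine (abs_sub_taylorPoly_le hL (by linarith) hg h x x').trans ?_
  rcases eq_or_ne x' x with rfl | hne
  · rw [sub_self, norm_zero, Real.zero_rpow (by linarith), zero_mul,
      Real.zero_rpow hβ.ne']
  · have : 0 < ‖x' - x‖ := norm_pos_iff.2 (sub_ne_zero.2 hne)
    rw [← Real.rpow_natCast, ← Real.rpow_add this, sub_add_cancel]

lemma norm_sum_le_of_pairwise_eq_zero {ι F : Type*} [SeminormedAddCommGroup F] {K : Finset ι}
    {f : ι → F} {M : ℝ} (hM : 0 ≤ M) (hf : ∀ i ∈ K, ‖f i‖ ≤ M)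
    (hd : ∀ i j, i ≠ j → f i = 0 ∨ f j = 0) : ‖∑ i ∈ K, f i‖ ≤ M := by
  by_cases h : ∃ i ∈ K, f i ≠ 0
  · obtain ⟨i, hi, hne⟩ := h
    rw [Finset.sum_eq_single i (fun j _ hj => (hd i j hj.symm).resolve_left hne)
      (fun h => absurd hi h)]
    exact hf i hi
  · push Not at h
    rwa [Finset.sum_eq_zero h, norm_zero]

/-- Packing disjointly supported translates of a smooth bump, with heights `±q^{-β}` at scale
`q⁻¹`, gives functions that are `β`-Hölder uniformly in `q` and in the number of bumps. -/
lemma exists_holder_bump_sum {d : ℕ} {β : ℝ} (hβ : 0 < β) {u : Euc d → ℝ}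
    (hu : ContDiff ℝ (⌈β⌉₊ : ℕ) u) (hc : HasCompactSupport u) :
    ∃ M > (0 : ℝ), ∀ (ι : Type) (K : Finset ι) (z : ι → Euc d) (σ : ι → ℝ) (c κ q : ℝ),
      (∀ i j, i ≠ j → ∀ x, x - z i ∉ tsupport u ∨ x - z j ∉ tsupport u) →
      (∀ i, |σ i| ≤ 1) → 0 ≤ κ → 0 < q →
      (fun x => c + κ * q ^ (-β) * ∑ i ∈ K, σ i * u (q • x - z i)) ∈
        holderClass d β (κ * M) := by
  obtain ⟨k, hk⟩ : ∃ k, ⌈β⌉₊ = k + 1 := ⟨⌈β⌉₊ - 1, by have := Nat.ceil_pos.2 hβ; omega⟩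
  have hk1 : ⌈β⌉₊ - 1 = k := by omega
  have hkβ : (k : ℝ) < β := Nat.lt_ceil.1 (by omega)
  have hβk : β ≤ k + 1 := by have := Nat.le_ceil β; rw [hk] at this; exact_mod_cast this
  rw [hk] at hu
  have huk : ContDiff ℝ k u := hu.of_le (by exact_mod_cast Nat.le_succ k)
  obtain ⟨M₀, hM₀⟩ := (hc.iteratedFDeriv (𝕜 := ℝ) k).exists_bound_of_continuous
    (huk.continuous_iteratedFDeriv le_rfl)
  obtain ⟨M₁, hM₁⟩ := (hc.iteratedFDeriv (𝕜 := ℝ) (k + 1)).exists_bound_of_continuous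
    (hu.continuous_iteratedFDeriv le_rfl)
  set M : ℝ := max (2 * M₀) M₁ + 1 with hM
  have hM₀0 : 0 ≤ M₀ := (norm_nonneg _).trans (hM₀ 0)
  have hM₁0 : 0 ≤ M₁ := (norm_nonneg _).trans (hM₁ 0)
  have hMpos : 0 < M := by positivity
  refine ⟨M, hMpos, fun ι K z σ c κ q hz hσ hκ hq => ?_⟩
  set G : Euc d → ℝ := fun x => ∑ i ∈ K, σ i * u (x + -z i) with hG
  have hterm (i : ι) {j : ℕ} (hj : ContDiff ℝ j u) :
      ContDiff ℝ j (fun x => σ i * u (x + -z i)) :=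
    contDiff_const.mul (hj.comp (contDiff_id.add contDiff_const))
  have hGd : ContDiff ℝ (k + 1 : ℕ) G := ContDiff.sum fun i _ => hterm i hu
  have hGk : ContDiff ℝ k G := ContDiff.sum fun i _ => hterm i huk
  have hbound {j : ℕ} (hj : ContDiff ℝ j u) {B : ℝ} (hB : 0 ≤ B)
      (hb : ∀ x, ‖iteratedFDeriv ℝ j u x‖ ≤ B) (x : Euc d) :
      ‖iteratedFDeriv ℝ j G x‖ ≤ B := by
    have hi (i : ι) : iteratedFDeriv ℝ j (fun x => σ i * u (x + -z i)) x =
        σ i • iteratedFDeriv ℝ j u (x + -z i) := by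
      have := iteratedFDeriv_const_smul_apply' (𝕜 := ℝ) (a := σ i) (i := j) (x := x)
        (f := fun x => u (x + -z i)) (hj.comp (contDiff_id.add contDiff_const)).contDiffAt
      simpa [iteratedFDeriv_comp_add_right] using this
    rw [hG, iteratedFDeriv_fun_sum_apply fun i _ => (hterm i hj).contDiffAt]
    simp only [hi]
    refine norm_sum_le_of_pairwise_eq_zero hB (fun i _ => ?_) fun i i' hne => ?_
    · rw [norm_smul, Real.norm_eq_abs]
      calc _ ≤ 1 * B := by gcongr; exacts [hσ i, hb _]
        _ = B := one_mul B
    · simp only [← sub_eq_add_neg]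
      have h0 (l : ι) (hl : x - z l ∉ tsupport u) :
          σ l • iteratedFDeriv ℝ j u (x - z l) = 0 := by
        rw [show iteratedFDeriv ℝ j u (x - z l) = 0 by
          by_contra h
          exact hl (support_iteratedFDeriv_subset j (Function.mem_support.2 h)), smul_zero]
      exact (hz i i' hne x).imp (h0 i) (h0 i')
  have hGhol (x y : Euc d) : ‖iteratedFDeriv ℝ k G y - iteratedFDeriv ℝ k G x‖ ≤
      M * ‖y - x‖ ^ (β - k) := by
    rcases le_total ‖y - x‖ 1 with hle | hge
    · have hlip : ‖iteratedFDeriv ℝ k G y - iteratedFDeriv ℝ k G x‖ ≤ M₁ * ‖y - x‖ := by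
        refine Convex.norm_image_sub_le_of_norm_fderiv_le (𝕜 := ℝ) (s := Set.univ) (fun w _ => ?_)
          (fun w _ => ?_) convex_univ (Set.mem_univ _) (Set.mem_univ _)
        · exact hGd.differentiable_iteratedFDeriv (by exact_mod_cast Nat.lt_succ_self k) w
        · rw [norm_fderiv_iteratedFDeriv]
          exact hbound hu hM₁0 hM₁ w
      refine hlip.trans ?_
      have : ‖y - x‖ ≤ ‖y - x‖ ^ (β - k) := by
        rcases (norm_nonneg (y - x)).eq_or_lt with h0 | h0
        · rw [← h0, Real.zero_rpow (by linarith)]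
        · conv_lhs => rw [← Real.rpow_one ‖y - x‖]
          exact Real.rpow_le_rpow_of_exponent_ge h0 hle (by linarith)
      gcongr
      exact (le_max_right _ _).trans (by rw [hM]; linarith)
    · calc _ ≤ ‖iteratedFDeriv ℝ k G y‖ + ‖iteratedFDeriv ℝ k G x‖ := norm_sub_le _ _
        _ ≤ M₀ + M₀ := add_le_add (hbound huk hM₀0 hM₀ y) (hbound huk hM₀0 hM₀ x)
        _ ≤ M * 1 := by rw [hM]; linarith [le_max_left (2 * M₀) M₁]
        _ ≤ _ := by gcongr; exact Real.one_le_rpow hge (by linarith)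
  have hfun : (fun x => c + κ * q ^ (-β) * ∑ i ∈ K, σ i * u (q • x - z i)) =
      fun x => c + (κ * q ^ (-β)) • G (q • x) := by
    ext x; simp [hG, sub_eq_add_neg]
  have hGq : ContDiff ℝ k (fun x : Euc d => G (q • x)) := hGk.comp (contDiff_const_smul q)
  have hcon (x y : Euc d) : iteratedFDeriv ℝ k (fun _ : Euc d => c) x =
      iteratedFDeriv ℝ k (fun _ : Euc d => c) y := by
    rcases k with _ | k
    · ext; simp
    · simp [iteratedFDeriv_succ_const]
  have hder (x : Euc d) : iteratedFDeriv ℝ k (fun x => c + (κ * q ^ (-β)) • G (q • x)) x =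
      iteratedFDeriv ℝ k (fun _ => c) x +
        (κ * q ^ (-β)) • q ^ k • iteratedFDeriv ℝ k G (q • x) := by
    rw [fun_iteratedFDeriv_add_apply contDiff_const.contDiffAt
      (hGq.const_smul (κ * q ^ (-β))).contDiffAt,
      iteratedFDeriv_const_smul_apply' hGq.contDiffAt, iteratedFDeriv_comp_const_smul q hGk]
  rw [hfun]
  refine mem_holderClass_of_holder_iteratedFDeriv hβ (by positivity) ?_ ?_
  · rw [hk1]
    exact contDiff_const.add (hGq.const_smul _)
  · rw [hk1]
    intro x y
    rw [hder, hder, hcon x y, add_sub_add_left_eq_sub, ← smul_sub, ← smul_sub, norm_smul, norm_smul,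
      norm_pow, Real.norm_of_nonneg hq.le, Real.norm_of_nonneg (by positivity)]
    calc _ ≤ κ * q ^ (-β) * (q ^ k * (M * ‖q • y - q • x‖ ^ (β - k))) := by
          gcongr; exact hGhol _ _
      _ = κ * M * ‖y - x‖ ^ (β - k) * (q ^ (-β) * q ^ (k : ℝ) * q ^ (β - k)) := by
          rw [← smul_sub, norm_smul, Real.norm_of_nonneg hq.le,
            Real.mul_rpow hq.le (norm_nonneg _), Real.rpow_natCast]
          ring
      _ = _ := by
          rw [← Real.rpow_add hq, ← Real.rpow_add hq,
            show -β + k + (β - k) = 0 by ring, Real.rpow_zero, mul_one]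

end HolderClass

/-! ### The grid of cubes carrying the marginal distribution -/

section Grid

/-- The left halves of the `q` intervals of length `1 / q` that make up `[0, 1]`. -/
def comb (q : ℕ) : Set ℝ := ⋃ j : Fin q, Set.Icc ((j : ℝ) / q) ((j : ℝ) / q + 1 / (2 * q))

lemma isCompact_comb (q : ℕ) : IsCompact (comb q) := isCompact_iUnion fun _ => isCompact_Icc

lemma div_add_half_le_one {q : ℕ} (j : Fin q) : (j : ℝ) / q + 1 / (2 * q) ≤ 1 := by
  have hq : (0 : ℝ) < q := by exact_mod_cast j.pos
  have hj : (j : ℝ) + 1 ≤ q := by exact_mod_cast j.2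
  rw [show (j : ℝ) / q + 1 / (2 * q) = (j + 1 / 2) / q by field_simp, div_le_one hq]
  linarith

lemma comb_subset (q : ℕ) : comb q ⊆ Set.Icc 0 1 :=
  Set.iUnion_subset fun j => Set.Icc_subset_Icc (by positivity) (div_add_half_le_one j)

lemma eq_of_mem_Icc_of_mem_Icc {q i j : ℕ} (hq : 0 < q) {t : ℝ}
    (hi : t ∈ Set.Icc ((i : ℝ) / q) ((i : ℝ) / q + 1 / (2 * q)))
    (hj : t ∈ Set.Icc ((j : ℝ) / q) ((j : ℝ) / q + 1 / (2 * q))) : i = j := by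
  have hq' : (0 : ℝ) < q := by exact_mod_cast hq
  have key {a b : ℕ} (ha : (a : ℝ) / q ≤ t) (hb : t ≤ (b : ℝ) / q + 1 / (2 * q)) : a ≤ b := by
    have h : (a : ℝ) / q ≤ (b + 1 / 2) / q := (ha.trans hb).trans_eq (by field_simp)
    rw [div_le_div_iff_of_pos_right hq'] at h
    have : (a : ℝ) < b + 1 := by linarith
    exact Nat.lt_succ_iff.1 (by exact_mod_cast this)
  exact le_antisymm (key hi.1 hj.2) (key hj.1 hi.2)

lemma volume_comb {q : ℕ} (hq : 0 < q) : volume (comb q) = ENNReal.ofReal (1 / 2) := by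
  have hq' : (0 : ℝ) < q := by exact_mod_cast hq
  rw [comb, measure_iUnion (fun i j hij => Set.disjoint_left.2 fun t hi hj =>
    hij (Fin.ext (eq_of_mem_Icc_of_mem_Icc hq hi hj))) fun _ => measurableSet_Icc]
  simp only [Real.volume_Icc, add_sub_cancel_left, tsum_fintype, Finset.sum_const,
    Finset.card_univ, Fintype.card_fin]
  rw [← ENNReal.ofReal_nsmul, nsmul_eq_mul]
  congr 1
  field_simp

lemma mem_comb_or_sub_mem_comb {q : ℕ} {y : ℝ} (hy : y ∈ Set.Ico (0 : ℝ) 1) (hq : 0 < q) :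
    y ∈ comb q ∨ y - 1 / (2 * q) ∈ comb q := by
  have hq' : (0 : ℝ) < q := by exact_mod_cast hq
  have h0 : 0 ≤ q * y := mul_nonneg hq'.le hy.1
  have hlt : ⌊q * y⌋₊ < q := (Nat.floor_lt h0).2 (by nlinarith [hy.2])
  have h1 := Nat.floor_le h0
  have h2 := Nat.lt_floor_add_one (q * y)
  have e (a : ℝ) : a / q + 1 / (2 * q) = (a + 1 / 2) / q := by field_simp
  have e' : y - 1 / (2 * q) = (q * y - 1 / 2) / q := by field_simp
  have ey : y = (q * y) / q := by field_simp
  rcases le_total (q * y) (⌊q * y⌋₊ + 1 / 2) with h | h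
  · refine Or.inl (Set.mem_iUnion.2 ⟨⟨_, hlt⟩, ?_⟩)
    rw [Set.mem_Icc, e]
    constructor
    · rw [div_le_iff₀ hq']; linarith
    · rw [le_div_iff₀ hq']; linarith
  · refine Or.inr (Set.mem_iUnion.2 ⟨⟨_, hlt⟩, ?_⟩)
    rw [Set.mem_Icc, e, e', div_le_div_iff_of_pos_right hq', div_le_div_iff_of_pos_right hq']
    constructor
    · show ((⌊q * y⌋₊ : ℕ) : ℝ) ≤ _
      linarith
    · show _ ≤ ((⌊q * y⌋₊ : ℕ) : ℝ) + 1 / 2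
      linarith

lemma le_volume_comb_inter {q : ℕ} {x s : ℝ} (hx : x ∈ comb q) (hs : 0 < s) (hs1 : s ≤ 1) :
    ENNReal.ofReal (s / 4) ≤ volume (comb q ∩ Set.Icc (x - s) (x + s)) := by
  obtain ⟨j, hj⟩ := Set.mem_iUnion.1 hx
  have hq : 0 < q := j.pos
  have hq' : (0 : ℝ) < q := by exact_mod_cast hq
  have hx01 := comb_subset q hx
  have hle {a b : ℝ} (hab : s / 4 = b - a) {T : Set ℝ} (h : Set.Icc a b ⊆ T) :
      ENNReal.ofReal (s / 4) ≤ volume T := by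
    rw [hab, ← Real.volume_Icc]
    exact measure_mono h
  rcases le_total (1 / q : ℝ) s with hsq | hsq
  · have hw : (1 : ℝ) / (2 * q) ≤ s / 2 := by
      rw [show (1 : ℝ) / (2 * q) = 1 / q / 2 by field_simp]; linarith
    have hw0 : (0 : ℝ) < 1 / (2 * q) := by positivity
    set w : ℝ := 1 / (2 * q) with hwdef
    set B := comb q ∩ Set.Icc (x - s) (x + s) with hB
    have hcover : Set.Icc (x - s / 2) (x + s / 2) ∩ Set.Ico 0 1 ⊆ B ∪ (fun y => y - w) ⁻¹' B := by
      rintro y ⟨hy, hy01⟩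
      rcases mem_comb_or_sub_mem_comb hy01 hq with h | h
      · exact Or.inl ⟨h, by linarith [hy.1], by linarith [hy.2]⟩
      · exact Or.inr ⟨h, by linarith [hy.1], by linarith [hy.2]⟩
    have hvol : ENNReal.ofReal (s / 2) ≤
        volume (Set.Icc (x - s / 2) (x + s / 2) ∩ Set.Ico 0 1) := by
      rcases le_total x (1 / 2) with h | h
      · rw [show s / 2 = (x + s / 2) - x by ring, ← Real.volume_Ico]
        exact measure_mono fun y hy => ⟨⟨by linarith [hy.1], by linarith [hy.2]⟩,
          by linarith [hy.1, hx01.1], by linarith [hy.2]⟩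
      · rw [show s / 2 = x - (x - s / 2) by ring, ← Real.volume_Ico]
        exact measure_mono fun y hy => ⟨⟨by linarith [hy.1], by linarith [hy.2]⟩,
          by linarith [hy.1], by linarith [hy.2, hx01.2]⟩
    have h2 : ENNReal.ofReal (s / 2) ≤ volume B + volume B := by
      refine (hvol.trans (measure_mono hcover)).trans ((measure_union_le _ _).trans_eq ?_)
      simp only [sub_eq_add_neg, measure_preimage_add_right]
    rw [show s / 2 = s / 4 + s / 4 by ring, ENNReal.ofReal_add (by positivity) (by positivity),
      ← two_mul, ← two_mul] at h2
    exact (ENNReal.mul_le_mul_iff_right two_ne_zero ENNReal.ofNat_ne_top).1 h2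
  · have hw : s / 4 ≤ 1 / (2 * q) / 2 := by
      rw [show (1 : ℝ) / (2 * q) / 2 = 1 / q / 4 by field_simp; norm_num]; linarith
    rcases le_total x ((j : ℝ) / q + 1 / (2 * q) / 2) with h | h
    · refine hle (a := x) (b := x + s / 4) (by ring) fun y hy => ⟨Set.mem_iUnion.2 ⟨j, ?_, ?_⟩,
        ?_, ?_⟩ <;> linarith [hj.1, hj.2, hy.1, hy.2]
    · refine hle (a := x - s / 4) (b := x) (by ring) fun y hy => ⟨Set.mem_iUnion.2 ⟨j, ?_, ?_⟩,
        ?_, ?_⟩ <;> linarith [hj.1, hj.2, hy.1, hy.2]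

/-- The coordinate box `∏ Tᵢ` in Euclidean space. -/
def box {d : ℕ} (T : Fin d → Set ℝ) : Set (Euc d) := {x | ∀ i, x i ∈ T i}

lemma box_eq_preimage {d : ℕ} (T : Fin d → Set ℝ) :
    box T = (WithLp.ofLp : Euc d → Fin d → ℝ) ⁻¹' Set.univ.pi T := by
  ext x; simp [box]

lemma isCompact_box {d : ℕ} {T : Fin d → Set ℝ} (hT : ∀ i, IsCompact (T i)) :
    IsCompact (box T) := by
  have : box T = WithLp.toLp 2 '' Set.univ.pi T := by
    ext x
    constructor
    · intro hx
      exact ⟨WithLp.ofLp x, fun i _ => hx i, rfl⟩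
    · rintro ⟨y, hy, rfl⟩ i
      exact hy i trivial
  rw [this]
  exact (isCompact_univ_pi hT).image (PiLp.continuous_toLp 2 _)

lemma volume_box {d : ℕ} {T : Fin d → Set ℝ} (hT : ∀ i, MeasurableSet (T i)) :
    volume (box T) = ∏ i, volume (T i) := by
  rw [box_eq_preimage, (PiLp.volume_preserving_ofLp (Fin d)).measure_preimage
    (MeasurableSet.univ_pi hT).nullMeasurableSet, volume_pi_pi]

/-- The cube of side `1 / (2 * q)` with lower corner `k / q`. -/
def cell {d : ℕ} (q : ℕ) (k : Fin d → Fin q) : Set (Euc d) :=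
  box fun i => Set.Icc ((k i : ℝ) / q) ((k i : ℝ) / q + 1 / (2 * q))

/-- The union of all cells. -/
def grid (d q : ℕ) : Set (Euc d) := box fun _ => comb q

lemma mem_grid_iff {d q : ℕ} {x : Euc d} : x ∈ grid d q ↔ ∃ k : Fin d → Fin q, x ∈ cell q k := by
  constructor
  · intro h
    choose k hk using fun i => Set.mem_iUnion.1 (h i)
    exact ⟨k, hk⟩
  · rintro ⟨k, hk⟩ i
    exact Set.mem_iUnion.2 ⟨k i, hk i⟩

lemma isCompact_grid (d q : ℕ) : IsCompact (grid d q) := isCompact_box fun _ => isCompact_comb q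

lemma isCompact_cell {d q : ℕ} (k : Fin d → Fin q) : IsCompact (cell q k) :=
  isCompact_box fun _ => isCompact_Icc

lemma cell_subset_grid {d q : ℕ} (k : Fin d → Fin q) : cell q k ⊆ grid d q :=
  fun _ hx => mem_grid_iff.2 ⟨k, hx⟩

lemma eq_of_mem_cell {d q : ℕ} (hq : 0 < q) {k l : Fin d → Fin q} {x : Euc d}
    (hk : x ∈ cell q k) (hl : x ∈ cell q l) : k = l :=
  funext fun i => Fin.ext (eq_of_mem_Icc_of_mem_Icc hq (hk i) (hl i))

lemma regularSet_grid {d : ℕ} (hd : 1 ≤ d) (q : ℕ) :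
    regularSet d ((1 / (8 * d)) ^ d) 1 (grid d q) := by
  have hd' : (1 : ℝ) ≤ d := by exact_mod_cast hd
  intro x hx r hr hr1
  set s : ℝ := r / d with hs
  have hspos : 0 < s := by positivity
  have hs1 : s ≤ 1 := (div_le_one (by positivity)).2 (by linarith)
  have hball : volume (Metric.closedBall x r) ≤ ENNReal.ofReal (2 * r) ^ d := by
    have hsub : Metric.closedBall x r ⊆ box fun i => Set.Icc (x i - r) (x i + r) := by
      intro y hy i
      have h := (PiLp.norm_apply_le (y - x) i).trans (mem_closedBall_iff_norm.1 hy)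
      rw [PiLp.sub_apply, Real.norm_eq_abs, abs_le] at h
      exact ⟨by linarith [h.1], by linarith [h.2]⟩
    refine (measure_mono hsub).trans_eq ?_
    rw [volume_box fun _ => measurableSet_Icc]
    simp only [Real.volume_Icc, add_sub_sub_cancel, Finset.prod_const, Finset.card_univ,
      Fintype.card_fin, two_mul]
  have hinner : (box fun i => comb q ∩ Set.Icc (x i - s) (x i + s)) ⊆
      grid d q ∩ Metric.closedBall x r := by
    intro y hy
    refine ⟨fun i => (hy i).1, mem_closedBall_iff_norm.2 ?_⟩
    rw [EuclideanSpace.norm_eq]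
    refine Real.sqrt_le_iff.2 ⟨hr.le, ?_⟩
    calc ∑ i, ‖(y - x) i‖ ^ 2 ≤ ∑ _i : Fin d, s ^ 2 := by
          refine Finset.sum_le_sum fun i _ => ?_
          have h := (hy i).2
          rw [PiLp.sub_apply, Real.norm_eq_abs, sq_abs]
          exact sq_le_sq' (by linarith [h.1]) (by linarith [h.2])
      _ = d * s ^ 2 := by simp
      _ ≤ d * (d * s ^ 2) := by gcongr; nlinarith [sq_nonneg s]
      _ = r ^ 2 := by rw [hs]; field_simp
  calc _ ≤ ENNReal.ofReal ((1 / (8 * d)) ^ d) * ENNReal.ofReal (2 * r) ^ d := by gcongr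
    _ = ENNReal.ofReal (s / 4) ^ d := by
        rw [← ENNReal.ofReal_pow (by positivity), ← ENNReal.ofReal_mul (by positivity),
          ← ENNReal.ofReal_pow (by positivity), ← mul_pow]
        congr 2
        rw [hs]; field_simp; norm_num
    _ = ∏ _i : Fin d, ENNReal.ofReal (s / 4) := by simp
    _ ≤ ∏ i, volume (comb q ∩ Set.Icc (x i - s) (x i + s)) :=
        Finset.prod_le_prod' fun i _ => le_volume_comb_inter (hx i) hspos hs1
    _ = volume (box fun i => comb q ∩ Set.Icc (x i - s) (x i + s)) :=
        (volume_box fun _ => (isCompact_comb q).measurableSet.inter measurableSet_Icc).symm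
    _ ≤ _ := measure_mono hinner

/-- The uniform distribution on the grid. -/
def gridMeasure (d q : ℕ) : Measure (Euc d) :=
  ENNReal.ofReal (2 ^ d) • volume.restrict (grid d q)

lemma isProbabilityMeasure_gridMeasure (d : ℕ) {q : ℕ} (hq : 0 < q) :
    IsProbabilityMeasure (gridMeasure d q) := by
  constructor
  rw [gridMeasure, Measure.smul_apply, Measure.restrict_apply_univ, grid,
    volume_box fun _ => (isCompact_comb q).measurableSet]
  simp only [volume_comb hq, Finset.prod_const, Finset.card_univ, Fintype.card_fin, smul_eq_mul]
  rw [← ENNReal.ofReal_pow (by norm_num), ← ENNReal.ofReal_mul (by positivity), ← mul_pow]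
  norm_num

lemma gridMeasure_cell {d q : ℕ} (hq : 0 < q) (k : Fin d → Fin q) :
    gridMeasure d q (cell q k) = ENNReal.ofReal ((1 / q) ^ d) := by
  have hq' : (0 : ℝ) < q := by exact_mod_cast hq
  rw [gridMeasure, Measure.smul_apply, Measure.restrict_apply (isCompact_cell k).measurableSet,
    Set.inter_eq_left.2 (cell_subset_grid k), cell, volume_box fun _ => measurableSet_Icc]
  simp only [Real.volume_Icc, add_sub_cancel_left, Finset.prod_const, Finset.card_univ,
    Fintype.card_fin, smul_eq_mul]
  rw [← ENNReal.ofReal_pow (by positivity), ← ENNReal.ofReal_mul (by positivity), ← mul_pow]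
  congr 2
  field_simp

lemma ae_mem_grid (d q : ℕ) : ∀ᵐ x ∂gridMeasure d q, x ∈ grid d q :=
  Measure.ae_smul_measure (ae_restrict_mem (isCompact_grid d q).measurableSet) _

lemma strongDensity_gridMeasure {d : ℕ} (hd : 1 ≤ d) (q : ℕ) :
    strongDensity d ((1 / (8 * d)) ^ d) 1 (1 / 2) (2 ^ d) (box fun _ => Set.Icc 0 1)
      (gridMeasure d q) := by
  refine ⟨grid d q, isCompact_grid d q, fun x hx i => comb_subset q (hx i), regularSet_grid hd q,
    (grid d q).indicator fun _ => 2 ^ d, fun x hx => ?_, fun x hx => ?_, ?_⟩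
  · rw [Set.indicator_of_mem hx]
    exact ⟨by linarith [one_le_pow₀ (n := d) (one_le_two (α := ℝ))], le_rfl⟩
  · exact Set.indicator_of_notMem hx _
  · have : (fun x => ENNReal.ofReal ((grid d q).indicator (fun _ => (2 : ℝ) ^ d) x)) =
        (grid d q).indicator fun _ => ENNReal.ofReal (2 ^ d) := by
      ext x
      by_cases hx : x ∈ grid d q <;> simp [hx]
    rw [this, withDensity_indicator (isCompact_grid d q).measurableSet, withDensity_const]
    rfl

lemma exists_cube_bump (d : ℕ) : ∃ u : Euc d → ℝ, (∀ n : ℕ, ContDiff ℝ n u) ∧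
    HasCompactSupport u ∧ (∀ x, u x ∈ Set.Icc (0 : ℝ) 1) ∧
    (∀ x : Euc d, (∀ i, x i ∈ Set.Icc (0 : ℝ) (1 / 2)) → u x = 1) ∧
    tsupport u ⊆ box fun _ => Metric.closedBall (1 / 4 : ℝ) (1 / 3) := by
  let b : ContDiffBump (1 / 4 : ℝ) := ⟨1 / 4, 1 / 3, by norm_num, by norm_num⟩
  have hK : IsCompact (box (d := d) fun _ => Metric.closedBall (1 / 4 : ℝ) (1 / 3)) :=
    isCompact_box fun _ => isCompact_closedBall _ _
  have hsupp : tsupport (fun x : Euc d => ∏ i, b (x i)) ⊆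
      box fun _ => Metric.closedBall (1 / 4 : ℝ) (1 / 3) := by
    refine closure_minimal (fun x hx i => ?_) hK.isClosed
    have h : b (x i) ≠ 0 := Finset.prod_ne_zero_iff.1 hx i (Finset.mem_univ i)
    have h' : x i ∈ Function.support b := h
    rw [b.support_eq] at h'
    exact Metric.ball_subset_closedBall h'
  refine ⟨fun x => ∏ i, b (x i), fun n => ?_, hK.of_isClosed_subset (isClosed_tsupport _) hsupp,
    fun x => ⟨Finset.prod_nonneg fun i _ => b.nonneg,
      Finset.prod_le_one (fun i _ => b.nonneg) fun i _ => b.le_one⟩, fun x hx => ?_, hsupp⟩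
  · refine contDiff_prod fun i _ => b.contDiff.comp ?_
    exact (EuclideanSpace.proj (𝕜 := ℝ) i).contDiff
  · refine Finset.prod_eq_one fun i _ => b.one_of_mem_closedBall ?_
    rw [Real.closedBall_eq_Icc]
    have := hx i
    constructor <;> simp only [b] <;> linarith [this.1, this.2]

end Grid

/-! ### Testing two product laws -/

section Testing

variable {Ω : Type*} [MeasurableSpace Ω]

lemma lintegral_pi_prod (ν : Measure Ω) [SigmaFinite ν] :
    ∀ {n : ℕ} {f : Fin n → Ω → ℝ≥0∞}, (∀ i, Measurable (f i)) →
      ∫⁻ ω, ∏ i, f i (ω i) ∂(Measure.pi fun _ => ν) = ∏ i, ∫⁻ x, f i x ∂ν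
  | 0, f, _ => by simp
  | n + 1, f, hf => by
      rw [← ((measurePreserving_piFinSuccAbove (fun _ => ν) 0).symm).lintegral_comp_emb
        (MeasurableEquiv.measurableEmbedding _), Fin.prod_univ_succ,
        ← lintegral_pi_prod ν fun i => hf i.succ, ← lintegral_prod_mul (hf 0).aemeasurable
          (Finset.measurable_prod _ fun i _ =>
            (hf i.succ).comp (measurable_pi_apply i)).aemeasurable]
      refine lintegral_congr fun z => ?_
      simp [Fin.prod_univ_succ, MeasurableEquiv.piFinSuccAbove_symm_apply, Fin.insertNthEquiv]

lemma pi_withDensity (n : ℕ) (ν : Measure Ω) [SigmaFinite ν] {g : Ω → ℝ≥0∞} (hg : Measurable g)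
    [SigmaFinite (ν.withDensity g)] :
    Measure.pi (fun _ : Fin n => ν.withDensity g) =
      (Measure.pi fun _ => ν).withDensity fun ω => ∏ i, g (ω i) := by
  refine Measure.pi_eq fun S hS => ?_
  have hind : (Set.univ.pi S).indicator (fun ω : Fin n → Ω => ∏ i, g (ω i)) =
      fun ω => ∏ i, (S i).indicator g (ω i) := by
    ext ω
    by_cases h : ω ∈ Set.univ.pi S
    · rw [Set.indicator_of_mem h]
      exact Finset.prod_congr rfl fun i _ => (Set.indicator_of_mem (h i trivial) g).symm
    · rw [Set.indicator_of_notMem h]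
      obtain ⟨i, hi⟩ : ∃ i, ω i ∉ S i := by simpa using h
      exact (Finset.prod_eq_zero (Finset.mem_univ i) (Set.indicator_of_notMem hi g)).symm
  rw [withDensity_apply _ (MeasurableSet.univ_pi hS), ← lintegral_indicator
    (MeasurableSet.univ_pi hS), hind, lintegral_pi_prod ν fun i => hg.indicator (hS i)]
  refine Finset.prod_congr rfl fun i _ => ?_
  rw [lintegral_indicator (hS i), withDensity_apply _ (hS i)]

lemma le_four_mul_min_add_max_div {s x y : ℝ≥0∞} (h : s ^ 2 ≤ x * y) :
    s ≤ 4 * min x y + 8⁻¹ * max x y := by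
  rw [← min_mul_max] at h
  refine (ENNReal.pow_le_pow_left_iff two_ne_zero).1 (h.trans ?_)
  have h8 : (8 : ℝ≥0∞) * 8⁻¹ = 1 := ENNReal.mul_inv_cancel (by norm_num) (by norm_num)
  calc min x y * max x y = (8 * 8⁻¹) * (min x y * max x y) := by rw [h8, one_mul]
    _ ≤ (8 * 8⁻¹) * (min x y * max x y) + ((4 * min x y) ^ 2 + (8⁻¹ * max x y) ^ 2) := le_self_add
    _ = _ := by ring

/-- If the affinity of two densities has `n`-th power at least `1/2`, no test based on an
`n`-sample distinguishes them with small error. -/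
lemma le_lintegral_pi_add_lintegral_pi {n : ℕ} {ν : Measure Ω} [SigmaFinite ν]
    {g g' s : Ω → ℝ≥0∞} (hg : Measurable g) (hg' : Measurable g') (hs : Measurable s)
    [IsProbabilityMeasure (ν.withDensity g)] [IsProbabilityMeasure (ν.withDensity g')]
    (hsg : ∀ x, s x ^ 2 ≤ g x * g' x) (hρ : 2⁻¹ ≤ (∫⁻ x, s x ∂ν) ^ n)
    {W W' : (Fin n → Ω) → ℝ≥0∞} (hW : Measurable W) (hW' : Measurable W')
    (hWW' : ∀ ω, 1 ≤ W ω + W' ω) :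
    16⁻¹ ≤ ∫⁻ ω, W ω ∂(Measure.pi fun _ => ν.withDensity g) +
      ∫⁻ ω, W' ω ∂(Measure.pi fun _ => ν.withDensity g') := by
  set G : (Fin n → Ω) → ℝ≥0∞ := fun ω => ∏ i, g (ω i) with hG
  set G' : (Fin n → Ω) → ℝ≥0∞ := fun ω => ∏ i, g' (ω i) with hG'
  have hprod {f : Ω → ℝ≥0∞} (hf : Measurable f) :
      Measurable fun ω : Fin n → Ω => ∏ i, f (ω i) :=
    Finset.measurable_prod _ fun i _ => hf.comp (measurable_pi_apply i)
  have hone {f : Ω → ℝ≥0∞} (hf : Measurable f) [IsProbabilityMeasure (ν.withDensity f)] :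
      ∫⁻ ω, ∏ i, f (ω i) ∂(Measure.pi fun _ : Fin n => ν) = 1 := by
    have : ∫⁻ x, f x ∂ν = 1 := by
      rw [← setLIntegral_univ, ← withDensity_apply _ MeasurableSet.univ, measure_univ]
    rw [lintegral_pi_prod ν fun _ => hf, this, Finset.prod_const_one]
  have hpt (ω : Fin n → Ω) : ∏ i, s (ω i) ≤
      4 * (G ω * W ω + G' ω * W' ω) + 8⁻¹ * (G ω + G' ω) := by
    have h1 : (∏ i, s (ω i)) ^ 2 ≤ G ω * G' ω := by
      rw [hG, hG', ← Finset.prod_pow, ← Finset.prod_mul_distrib]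
      exact Finset.prod_le_prod' fun i _ => hsg _
    refine (le_four_mul_min_add_max_div h1).trans ?_
    gcongr
    · calc min (G ω) (G' ω) ≤ min (G ω) (G' ω) * (W ω + W' ω) :=
            le_mul_of_one_le_right zero_le (hWW' ω)
        _ = min (G ω) (G' ω) * W ω + min (G ω) (G' ω) * W' ω := mul_add _ _ _
        _ ≤ _ := by gcongr; exacts [min_le_left _ _, min_le_right _ _]
    · exact max_le le_self_add le_add_self
  have hint : 2⁻¹ ≤ 4 * (∫⁻ ω, W ω ∂(Measure.pi fun _ => ν.withDensity g) +
      ∫⁻ ω, W' ω ∂(Measure.pi fun _ => ν.withDensity g')) + 8⁻¹ * (1 + 1) := by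
    calc (2⁻¹ : ℝ≥0∞) ≤ (∫⁻ x, s x ∂ν) ^ n := hρ
      _ = ∫⁻ ω, ∏ i, s (ω i) ∂(Measure.pi fun _ : Fin n => ν) := by
          rw [lintegral_pi_prod ν fun _ => hs, Fin.prod_const]
      _ ≤ _ := lintegral_mono hpt
      _ = _ := by
          have hGm : Measurable G := hprod hg
          have hGm' : Measurable G' := hprod hg'
          have m1 : Measurable fun ω => G ω * W ω := hGm.mul hW
          have m2 : Measurable fun ω => G ω * W ω + G' ω * W' ω := m1.add (hGm'.mul hW')
          have m3 : Measurable fun ω => 4 * (G ω * W ω + G' ω * W' ω) := m2.const_mul 4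
          have m4 : Measurable fun ω => G ω + G' ω := hGm.add hGm'
          rw [lintegral_add_left m3, lintegral_const_mul _ m2, lintegral_add_left m1,
            lintegral_const_mul _ m4, lintegral_add_left hGm, hone hg, hone hg',
            pi_withDensity n ν hg, pi_withDensity n ν hg',
            lintegral_withDensity_eq_lintegral_mul _ hGm hW,
            lintegral_withDensity_eq_lintegral_mul _ hGm' hW']
          rfl
  by_contra! hlt
  set I := ∫⁻ ω, W ω ∂(Measure.pi fun _ => ν.withDensity g) +
      ∫⁻ ω, W' ω ∂(Measure.pi fun _ => ν.withDensity g')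
  have hI : I ≠ ∞ := hlt.ne_top
  have h1 := (ENNReal.toReal_le_toReal (by simp) (by finiteness)).2 hint
  have h2 := (ENNReal.toReal_lt_toReal hI (by simp)).2 hlt
  rw [ENNReal.toReal_add (by finiteness) (by finiteness), ENNReal.toReal_mul,
    ENNReal.toReal_mul] at h1
  norm_num at h1 h2
  linarith

variable {d : ℕ}

lemma measurable_label_kernel {η : Euc d → ℝ} (hη : Measurable η) :
    Measurable fun x => ENNReal.ofReal (η x) • Measure.dirac (x, (1 : ℝ)) +
      ENNReal.ofReal (1 - η x) • Measure.dirac (x, (0 : ℝ)) := by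
  refine Measure.measurable_of_measurable_coe _ fun S hS => ?_
  have h (c : ℝ) : Measurable fun x : Euc d => Measure.dirac (x, c) S :=
    (Measure.measurable_coe hS).comp (Measure.measurable_dirac.comp (by fun_prop))
  simp only [Measure.add_apply, Measure.smul_apply, smul_eq_mul]
  exact (hη.ennreal_ofReal.mul (h 1)).add ((measurable_const.sub hη).ennreal_ofReal.mul (h 0))

lemma lintegral_joint {PX : Measure (Euc d)} {η : Euc d → ℝ} (hη : Measurable η)
    {F : Euc d × ℝ → ℝ≥0∞} (hF : Measurable F) :
    ∫⁻ z, F z ∂(joint d PX η) =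
      ∫⁻ x, (ENNReal.ofReal (η x) * F (x, 1) + ENNReal.ofReal (1 - η x) * F (x, 0)) ∂PX := by
  rw [joint, Measure.lintegral_bind (measurable_label_kernel hη).aemeasurable hF.aemeasurable]
  refine lintegral_congr fun x => ?_
  rw [lintegral_add_measure, lintegral_smul_measure, lintegral_smul_measure,
    lintegral_dirac' _ hF, lintegral_dirac' _ hF, smul_eq_mul, smul_eq_mul]

lemma isProbabilityMeasure_joint {PX : Measure (Euc d)} [IsProbabilityMeasure PX] {η : Euc d → ℝ}
    (hη : Measurable η) (hη01 : ∀ x, η x ∈ Set.Icc (0 : ℝ) 1) :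
    IsProbabilityMeasure (joint d PX η) := by
  constructor
  rw [← lintegral_one, lintegral_joint (F := fun _ => 1) hη measurable_const]
  calc _ = ∫⁻ _x, (1 : ℝ≥0∞) ∂PX := by
        refine lintegral_congr fun x => ?_
        rw [mul_one, mul_one, ← ENNReal.ofReal_add (hη01 x).1 (by linarith [(hη01 x).2])]
        simp
    _ = 1 := by simp

/-- The product of the marginal with the counting measure on the two labels. -/
def labelMeasure (PX : Measure (Euc d)) : Measure (Euc d × ℝ) :=
  PX.map (fun x => (x, 1)) + PX.map (fun x => (x, 0))

/-- Density of the joint law with respect to `labelMeasure`. -/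
def labelDensity (η : Euc d → ℝ) (z : Euc d × ℝ) : ℝ≥0∞ :=
  if z.2 = 1 then ENNReal.ofReal (η z.1) else ENNReal.ofReal (1 - η z.1)

lemma lintegral_labelMeasure {PX : Measure (Euc d)} {F : Euc d × ℝ → ℝ≥0∞} (hF : Measurable F) :
    ∫⁻ z, F z ∂(labelMeasure PX) = ∫⁻ x, (F (x, 1) + F (x, 0)) ∂PX := by
  rw [labelMeasure, lintegral_add_measure, lintegral_map hF (by fun_prop),
    lintegral_map hF (by fun_prop), lintegral_add_left (by fun_prop)]

instance (PX : Measure (Euc d)) [IsProbabilityMeasure PX] : IsFiniteMeasure (labelMeasure PX) := by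
  unfold labelMeasure; infer_instance

lemma measurable_labelDensity {η : Euc d → ℝ} (hη : Measurable η) :
    Measurable (labelDensity η) :=
  Measurable.ite (measurable_snd (measurableSet_singleton 1))
    (hη.comp measurable_fst).ennreal_ofReal
    (measurable_const.sub (hη.comp measurable_fst)).ennreal_ofReal

lemma joint_eq_withDensity {PX : Measure (Euc d)} {η : Euc d → ℝ} (hη : Measurable η) :
    joint d PX η = (labelMeasure PX).withDensity (labelDensity η) := by
  refine Measure.ext_of_lintegral _ fun F hF => ?_
  rw [lintegral_joint hη hF,
    lintegral_withDensity_eq_lintegral_mul _ (measurable_labelDensity hη) hF,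
    lintegral_labelMeasure ((measurable_labelDensity hη).mul hF)]
  simp [labelDensity]

/-- Two regression functions that differ, by at most `2 * a`, only on a set of mass of order
`(n a²)⁻¹` cannot be told apart from `n` observations. -/
lemma le_integral_sampleLaw_add_integral_sampleLaw {n : ℕ} {PX : Measure (Euc d)}
    [IsProbabilityMeasure PX] {η η' : Euc d → ℝ} (hη : Measurable η) (hη' : Measurable η')
    (hη01 : ∀ x, η x ∈ Set.Icc (0 : ℝ) 1) (hη01' : ∀ x, η' x ∈ Set.Icc (0 : ℝ) 1)
    {Q : Set (Euc d)} (hQm : MeasurableSet Q) {a : ℝ} (ha : 0 ≤ a) (ha2 : a ≤ 1 / 2)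
    (hQ : ∀ x ∈ Q, (η x = 1 / 2 + a ∧ η' x = 1 / 2 - a) ∨ (η x = 1 / 2 - a ∧ η' x = 1 / 2 + a))
    (hae : ∀ᵐ x ∂PX, x ∉ Q → η x = η' x) (hn : n * (4 * a ^ 2 * PX.real Q) ≤ 1 / 2)
    {W : (Fin n → Euc d × ℝ) → ℝ} (hW : Measurable W) (hW01 : ∀ D, W D ∈ Set.Icc (0 : ℝ) 1) :
    1 / 16 ≤ ∫ D, W D ∂(sampleLaw d n PX η) + ∫ D, (1 - W D) ∂(sampleLaw d n PX η') := by
  have hp := isProbabilityMeasure_joint (PX := PX) hη hη01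
  have hp' := isProbabilityMeasure_joint (PX := PX) hη' hη01'
  have h4a : 4 * a ^ 2 ≤ 1 := by nlinarith
  let s : Euc d × ℝ → ℝ≥0∞ := fun z => if z.1 ∈ Q then ENNReal.ofReal (1 / 2 * (1 - 4 * a ^ 2))
    else if η z.1 = η' z.1 then labelDensity η z else 0
  have hs : Measurable s :=
    Measurable.ite (measurable_fst hQm) measurable_const (Measurable.ite
      (measurableSet_eq_fun (hη.comp measurable_fst) (hη'.comp measurable_fst))
      (measurable_labelDensity hη) measurable_const)
  have hsg (z : Euc d × ℝ) : s z ^ 2 ≤ labelDensity η z * labelDensity η' z := by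
    by_cases hz : z.1 ∈ Q
    · have hr : (1 / 2 * (1 - 4 * a ^ 2)) ^ 2 ≤ (1 / 2 + a) * (1 / 2 - a) := by
        nlinarith [sq_nonneg a]
      simp only [s, if_pos hz, labelDensity]
      rw [← ENNReal.ofReal_pow (by linarith)]
      rcases hQ _ hz with ⟨h1, h2⟩ | ⟨h1, h2⟩ <;> split_ifs <;> rw [h1, h2] <;>
        rw [← ENNReal.ofReal_mul (by linarith)] <;> refine ENNReal.ofReal_le_ofReal ?_ <;>
        nlinarith
    · by_cases he : η z.1 = η' z.1
      · have : labelDensity η' z = labelDensity η z := by simp [labelDensity, he]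
        simp [s, hz, he, this, sq]
      · simp [s, hz, he]
  have hρ : ENNReal.ofReal (1 - 4 * a ^ 2 * PX.real Q) ≤ ∫⁻ z, s z ∂(labelMeasure PX) := by
    rw [lintegral_labelMeasure hs]
    have hint : ∫ x, (1 - Q.indicator (fun _ => 4 * a ^ 2) x) ∂PX = 1 - 4 * a ^ 2 * PX.real Q := by
      rw [integral_sub (integrable_const _) ((integrable_const _).indicator hQm),
        integral_indicator_const _ hQm]
      simp [mul_comm]
    have hi : Integrable (fun x => 1 - Q.indicator (fun _ => 4 * a ^ 2) x) PX :=
      (integrable_const _).sub ((integrable_const _).indicator hQm)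
    rw [← hint, ofReal_integral_eq_lintegral_ofReal hi (Filter.Eventually.of_forall fun x =>
      sub_nonneg.2 ((Set.indicator_le_self' (fun _ _ => by positivity) x).trans h4a))]
    refine lintegral_mono_ae (hae.mono fun x hx => ?_)
    by_cases hxQ : x ∈ Q
    · simp only [s, if_pos hxQ, Set.indicator_of_mem hxQ]
      rw [← ENNReal.ofReal_add (by linarith) (by linarith)]
      exact ENNReal.ofReal_le_ofReal (by linarith)
    · simp only [s, if_neg hxQ, Set.indicator_of_notMem hxQ, if_pos (hx hxQ), labelDensity]
      simp only [if_true, zero_ne_one, if_false]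
      rw [← ENNReal.ofReal_add (hη01 x).1 (by linarith [(hη01 x).2])]
      exact ENNReal.ofReal_le_ofReal (by linarith)
  have hρn : 2⁻¹ ≤ (∫⁻ z, s z ∂(labelMeasure PX)) ^ n := by
    have hQ1 : PX.real Q ≤ 1 := measureReal_le_one
    have hQ0 : 0 ≤ PX.real Q := measureReal_nonneg
    have h0 : 4 * a ^ 2 * PX.real Q ≤ 1 := mul_le_one₀ h4a hQ0 hQ1
    refine le_trans ?_ (pow_le_pow_left₀ zero_le hρ n)
    rw [← ENNReal.ofReal_pow (by linarith), show (2⁻¹ : ℝ≥0∞) = ENNReal.ofReal (1 / 2) by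
      rw [one_div, ENNReal.ofReal_inv_of_pos two_pos, ENNReal.ofReal_ofNat]]
    refine ENNReal.ofReal_le_ofReal ?_
    have hb := one_add_mul_le_pow (a := -(4 * a ^ 2 * PX.real Q)) (by linarith) n
    rw [← sub_eq_add_neg] at hb
    linarith
  have hI {η₀ : Euc d → ℝ} [IsProbabilityMeasure (joint d PX η₀)]
      {V : (Fin n → Euc d × ℝ) → ℝ} (hV : Measurable V) (hV01 : ∀ D, V D ∈ Set.Icc (0 : ℝ) 1) :
      ENNReal.ofReal (∫ D, V D ∂(sampleLaw d n PX η₀)) =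
        ∫⁻ D, ENNReal.ofReal (V D) ∂(sampleLaw d n PX η₀) := by
    have : IsProbabilityMeasure (sampleLaw d n PX η₀) := by unfold sampleLaw; infer_instance
    refine ofReal_integral_eq_lintegral_ofReal ?_ (Filter.Eventually.of_forall fun D => (hV01 D).1)
    exact Integrable.of_bound hV.aestronglyMeasurable 1
      (Filter.Eventually.of_forall fun D => by
        rw [Real.norm_of_nonneg (hV01 D).1]; exact (hV01 D).2)
  have hW1 (D) : 1 - W D ∈ Set.Icc (0 : ℝ) 1 :=
    ⟨by linarith [(hW01 D).2], by linarith [(hW01 D).1]⟩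
  have n1 : 0 ≤ ∫ D, W D ∂(sampleLaw d n PX η) := integral_nonneg fun D => (hW01 D).1
  have n2 : 0 ≤ ∫ D, (1 - W D) ∂(sampleLaw d n PX η') := integral_nonneg fun D => (hW1 D).1
  refine (ENNReal.ofReal_le_ofReal_iff (add_nonneg n1 n2)).1 ?_
  have hWm : Measurable fun D => 1 - W D := measurable_const.sub hW
  rw [ENNReal.ofReal_add n1 n2, hI hW hW01, hI hWm hW1]
  have e := joint_eq_withDensity (PX := PX) hη
  have e' := joint_eq_withDensity (PX := PX) hη'
  rw [e] at hp
  rw [e'] at hp'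
  have := le_lintegral_pi_add_lintegral_pi (measurable_labelDensity hη)
    (measurable_labelDensity hη') hs hsg hρn hW.ennreal_ofReal hWm.ennreal_ofReal fun D => by
      rw [← ENNReal.ofReal_add (hW01 D).1 (hW1 D).1]; simp
  rw [sampleLaw, sampleLaw, e, e', one_div, ENNReal.ofReal_inv_of_pos (by norm_num),
    ENNReal.ofReal_ofNat]
  exact this

end Testing

/-! ### Reduction to testing over a hypercube of regression functions -/

section Hypercube

variable {d n q : ℕ}

lemma measurable_plugin {η : Euc d → ℝ} (hη : Measurable η) : Measurable (plugin d η) :=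
  Measurable.ite (measurableSet_le measurable_const hη) measurable_const measurable_const

lemma abs_two_mul_sub_one_le {t : ℝ} (ht : t ∈ Set.Icc (0 : ℝ) 1) : |2 * t - 1| ≤ 1 :=
  abs_le.2 ⟨by linarith [ht.1], by linarith [ht.2]⟩

lemma measurable_excess_integrand {η : Euc d → ℝ} (hη : Measurable η)
    {fhat : (Fin n → Euc d × ℝ) → Euc d → Bool} (hf : Measurable (Function.uncurry fhat)) :
    Measurable fun z : (Fin n → Euc d × ℝ) × Euc d =>
      if fhat z.1 z.2 = plugin d η z.2 then 0 else |2 * η z.2 - 1| := by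
  refine Measurable.ite (measurableSet_eq_fun hf ((measurable_plugin hη).comp measurable_snd))
    measurable_const ?_
  have : Measurable fun z : (Fin n → Euc d × ℝ) × Euc d => η z.2 := hη.comp measurable_snd
  exact ((this.const_mul 2).sub_const 1).abs

lemma integrable_excess_integrand {PX : Measure (Euc d)} [IsProbabilityMeasure PX]
    {η : Euc d → ℝ} (hη : Measurable η) (hη01 : ∀ x, η x ∈ Set.Icc (0 : ℝ) 1)
    {fhat : (Fin n → Euc d × ℝ) → Euc d → Bool} (hf : Measurable (Function.uncurry fhat))
    (D : Fin n → Euc d × ℝ) :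
    Integrable (fun x => if fhat D x = plugin d η x then 0 else |2 * η x - 1|) PX := by
  refine Integrable.of_bound ((measurable_excess_integrand hη hf).comp
    measurable_prodMk_left).aestronglyMeasurable 1 (Filter.Eventually.of_forall fun x => ?_)
  split_ifs
  · simp
  · simpa using abs_two_mul_sub_one_le (hη01 x)

lemma isProbabilityMeasure_sampleLaw {PX : Measure (Euc d)} [IsProbabilityMeasure PX]
    {η : Euc d → ℝ} (hη : Measurable η) (hη01 : ∀ x, η x ∈ Set.Icc (0 : ℝ) 1) :
    IsProbabilityMeasure (sampleLaw d n PX η) := by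
  have := isProbabilityMeasure_joint (PX := PX) hη hη01
  unfold sampleLaw
  infer_instance

lemma integrable_excessRisk {PX : Measure (Euc d)} [IsProbabilityMeasure PX]
    {η : Euc d → ℝ} (hη : Measurable η) (hη01 : ∀ x, η x ∈ Set.Icc (0 : ℝ) 1)
    {fhat : (Fin n → Euc d × ℝ) → Euc d → Bool} (hf : Measurable (Function.uncurry fhat)) :
    Integrable (fun D => excessRisk d PX η (fhat D)) (sampleLaw d n PX η) := by
  have := isProbabilityMeasure_sampleLaw (n := n) (PX := PX) hη hη01
  refine Integrable.of_bound (StronglyMeasurable.integral_prod_right'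
    (measurable_excess_integrand hη hf).stronglyMeasurable).aestronglyMeasurable 1
    (Filter.Eventually.of_forall fun D => ?_)
  refine (norm_integral_le_of_norm_le_const (C := 1)
    (Filter.Eventually.of_forall fun x => ?_)).trans (by simp)
  split_ifs
  · simp
  · simpa using abs_two_mul_sub_one_le (hη01 x)

/-- The mass of the part of a cell on which the classifier does not predict the label `s`. -/
def cellError (q : ℕ) (fhat : (Fin n → Euc d × ℝ) → Euc d → Bool) (k : Fin d → Fin q) (s : Bool)
    (D : Fin n → Euc d × ℝ) : ℝ :=
  (gridMeasure d q).real (cell q k ∩ {x | fhat D x ≠ s})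

lemma measurableSet_cell_inter {fhat : (Fin n → Euc d × ℝ) → Euc d → Bool}
    (hf : Measurable (Function.uncurry fhat)) (k : Fin d → Fin q) (s : Bool)
    (D : Fin n → Euc d × ℝ) :
    MeasurableSet (cell q k ∩ {x | fhat D x ≠ s}) :=
  (isCompact_cell k).measurableSet.inter
    ((hf.comp measurable_prodMk_left) (measurableSet_singleton s)).compl

lemma measurable_cellError {fhat : (Fin n → Euc d × ℝ) → Euc d → Bool}
    (hf : Measurable (Function.uncurry fhat)) (hq : 0 < q) (k : Fin d → Fin q) (s : Bool) :
    Measurable (cellError q fhat k s) := by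
  have := isProbabilityMeasure_gridMeasure d hq
  have hS : MeasurableSet {z : (Fin n → Euc d × ℝ) × Euc d | z.2 ∈ cell q k ∧ fhat z.1 z.2 ≠ s} :=
    (measurable_snd (isCompact_cell k).measurableSet).inter
      (hf (measurableSet_singleton s)).compl
  exact (measurable_measure_prodMk_left (ν := gridMeasure d q) hS).ennreal_toReal

lemma cellError_add_cellError_not {fhat : (Fin n → Euc d × ℝ) → Euc d → Bool}
    (hf : Measurable (Function.uncurry fhat)) (hq : 0 < q) (k : Fin d → Fin q) (s : Bool)
    (D : Fin n → Euc d × ℝ) :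
    cellError q fhat k s D + cellError q fhat k (!s) D = (1 / q : ℝ) ^ d := by
  have := isProbabilityMeasure_gridMeasure d hq
  have hd : Disjoint (cell q k ∩ {x | fhat D x ≠ s}) (cell q k ∩ {x | fhat D x ≠ !s}) := by
    rw [Set.disjoint_left]
    rintro x ⟨_, h1⟩ ⟨_, h2⟩
    rcases hs : s <;> rcases hx : fhat D x <;> simp_all
  rw [cellError, cellError, ← measureReal_union hd (measurableSet_cell_inter hf k _ D),
    ← Set.inter_union_distrib_left, show {x | fhat D x ≠ s} ∪ {x | fhat D x ≠ !s} = Set.univ by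
      ext x; rcases hs : s <;> rcases hx : fhat D x <;> simp_all, Set.inter_univ,
    measureReal_def, gridMeasure_cell hq, ENNReal.toReal_ofReal (by positivity)]

lemma cellError_nonneg (fhat : (Fin n → Euc d × ℝ) → Euc d → Bool) (k : Fin d → Fin q) (s : Bool)
    (D : Fin n → Euc d × ℝ) : 0 ≤ cellError q fhat k s D := measureReal_nonneg

lemma sum_cellError_le_excessRisk (hq : 0 < q) {K : Finset (Fin d → Fin q)} {a : ℝ} (ha : 0 < a)
    {η : Euc d → ℝ} (hη : Measurable η) (hη01 : ∀ x, η x ∈ Set.Icc (0 : ℝ) 1)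
    {σ : (Fin d → Fin q) → Bool}
    (hK : ∀ k ∈ K, ∀ x ∈ cell q k, η x = 1 / 2 + if σ k then a else -a)
    {fhat : (Fin n → Euc d × ℝ) → Euc d → Bool} (hf : Measurable (Function.uncurry fhat))
    (D : Fin n → Euc d × ℝ) :
    ∑ k ∈ K, 2 * a * cellError q fhat k (σ k) D ≤ excessRisk d (gridMeasure d q) η (fhat D) := by
  have := isProbabilityMeasure_gridMeasure d hq
  have hi (k : Fin d → Fin q) : Integrable ((cell q k ∩ {x | fhat D x ≠ σ k}).indicator
      fun _ => 2 * a) (gridMeasure d q) :=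
    (integrable_const _).indicator (measurableSet_cell_inter hf k _ D)
  calc ∑ k ∈ K, 2 * a * cellError q fhat k (σ k) D
      = ∫ x, ∑ k ∈ K, (cell q k ∩ {x | fhat D x ≠ σ k}).indicator (fun _ => 2 * a) x
          ∂(gridMeasure d q) := by
        rw [integral_finsetSum _ fun k _ => hi k]
        refine Finset.sum_congr rfl fun k _ => ?_
        rw [integral_indicator_const _ (measurableSet_cell_inter hf k _ D), cellError, smul_eq_mul,
          mul_comm]
    _ ≤ _ := by
        refine integral_mono (integrable_finsetSum _ fun k _ => hi k)
          (integrable_excess_integrand hη hη01 hf D) fun x => ?_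
        by_cases hx : ∃ k ∈ K, x ∈ cell q k ∩ {x | fhat D x ≠ σ k}
        · obtain ⟨k, hkK, hxk, hne⟩ := hx
          have hηx := hK k hkK x hxk
          have hp : plugin d η x = σ k := by
            rcases hs : σ k <;> simp only [plugin, hηx, hs] <;> simp <;> linarith
          have habs : |2 * η x - 1| = 2 * a := by
            rw [hηx]
            split_ifs
            · rw [abs_of_pos] <;> linarith
            · rw [abs_of_neg] <;> linarith
          dsimp only
          rw [Finset.sum_eq_single_of_mem k hkK fun l _ hl => Set.indicator_of_notMem
            (fun h => hl (eq_of_mem_cell hq h.1 hxk)) _,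
            Set.indicator_of_mem (show x ∈ _ ∩ _ from ⟨hxk, hne⟩), hp, if_neg hne, habs]
        · dsimp only
          rw [Finset.sum_eq_zero fun k hk => Set.indicator_of_notMem
            (fun h => hx ⟨k, hk, h⟩) _]
          split_ifs <;> positivity

/-- Assouad's lemma for a family of regression functions indexed by the labels of the cells. -/
lemma exists_le_expectedExcess (hq : 0 < q) {K : Finset (Fin d → Fin q)} {a : ℝ} (ha : 0 < a)
    (ha2 : a ≤ 1 / 2) (hn : n * (4 * a ^ 2 * (1 / q : ℝ) ^ d) ≤ 1 / 2)
    {η : ((Fin d → Fin q) → Bool) → Euc d → ℝ} (hη : ∀ σ, Measurable (η σ))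
    (hη01 : ∀ σ x, η σ x ∈ Set.Icc (0 : ℝ) 1)
    (hK : ∀ σ, ∀ k ∈ K, ∀ x ∈ cell q k, η σ x = 1 / 2 + if σ k then a else -a)
    (hK' : ∀ σ, ∀ k ∉ K, ∀ x ∈ cell q k, η σ x = 1 / 2)
    {fhat : (Fin n → Euc d × ℝ) → Euc d → Bool} (hf : Measurable (Function.uncurry fhat)) :
    ∃ σ, K.card * (a * (1 / q : ℝ) ^ d / 16) ≤
      expectedExcess d n (gridMeasure d q) (η σ) fhat := by
  have := isProbabilityMeasure_gridMeasure d hq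
  have hprob (σ) := isProbabilityMeasure_sampleLaw (n := n) (PX := gridMeasure d q) (hη σ) (hη01 σ)
  set ω : ℝ := (1 / q : ℝ) ^ d with hω
  have hω0 : 0 < ω := by positivity
  have hle (k : Fin d → Fin q) (s : Bool) (D) : cellError q fhat k s D ≤ ω := by
    linarith [cellError_add_cellError_not hf hq k s D, cellError_nonneg fhat k (!s) D]
  have hint (σ) (k : Fin d → Fin q) (s : Bool) :
      Integrable (cellError q fhat k s) (sampleLaw d n (gridMeasure d q) (η σ)) :=
    Integrable.of_bound (measurable_cellError hf hq k s).aestronglyMeasurable ω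
      (Filter.Eventually.of_forall fun D => by
        rw [Real.norm_of_nonneg (cellError_nonneg fhat k s D)]; exact hle k s D)
  set e : ((Fin d → Fin q) → Bool) → (Fin d → Fin q) → ℝ := fun σ k =>
    ∫ D, cellError q fhat k (σ k) D ∂(sampleLaw d n (gridMeasure d q) (η σ)) with he
  have hexc (σ) : ∑ k ∈ K, 2 * a * e σ k ≤ expectedExcess d n (gridMeasure d q) (η σ) fhat := by
    calc _ = ∫ D, ∑ k ∈ K, 2 * a * cellError q fhat k (σ k) D
          ∂(sampleLaw d n (gridMeasure d q) (η σ)) := by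
          rw [integral_finsetSum _ fun k _ => (hint σ k (σ k)).const_mul _]
          simp only [he, integral_const_mul]
      _ ≤ _ := integral_mono (integrable_finsetSum _ fun k _ => (hint σ k (σ k)).const_mul _)
          (integrable_excessRisk (hη σ) (hη01 σ) hf)
          fun D => sum_cellError_le_excessRisk hq ha (hη σ) (hη01 σ) (hK σ) hf D
  have hflip (k : Fin d → Fin q) :
      Function.Involutive fun σ : (Fin d → Fin q) → Bool => Function.update σ k (!σ k) := by
    intro σ
    simp
  have htwo (σ) (k) (hk : k ∈ K) : ω / 16 ≤ e σ k + e (Function.update σ k (!σ k)) k := by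
    set τ := Function.update σ k (!σ k) with hτ
    have hτk : τ k = !σ k := by simp [hτ]
    have key := le_integral_sampleLaw_add_integral_sampleLaw (n := n) (PX := gridMeasure d q)
      (hη σ) (hη τ) (hη01 σ) (hη01 τ) (isCompact_cell k).measurableSet ha.le ha2
      (fun x hx => by
        rw [hK σ k hk x hx, hK τ k hk x hx, hτk]
        rcases σ k <;> simp [sub_eq_add_neg])
      ((ae_mem_grid d q).mono fun x hx hxk => by
        obtain ⟨l, hl⟩ := mem_grid_iff.1 hx
        have hlk : l ≠ k := fun h => hxk (h ▸ hl)
        by_cases hlK : l ∈ K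
        · rw [hK σ l hlK x hl, hK τ l hlK x hl, hτ, Function.update_of_ne hlk]
        · rw [hK' σ l hlK x hl, hK' τ l hlK x hl])
      (by rwa [measureReal_def, gridMeasure_cell hq, ENNReal.toReal_ofReal hω0.le])
      (W := fun D => cellError q fhat k (σ k) D / ω)
      ((measurable_cellError hf hq k (σ k)).div_const ω)
      (fun D => ⟨div_nonneg (cellError_nonneg fhat k _ D) hω0.le,
        (div_le_one hω0).2 (hle k _ D)⟩)
    have hsub (D) : 1 - cellError q fhat k (σ k) D / ω = cellError q fhat k (τ k) D / ω := by
      rw [hτk, eq_div_iff hω0.ne', sub_mul, div_mul_cancel₀ _ hω0.ne', one_mul]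
      linarith [cellError_add_cellError_not hf hq k (σ k) D]
    simp only [hsub, integral_div] at key
    rw [← add_div, le_div_iff₀ hω0] at key
    simp only [he]
    linarith
  have hsum (k) (hk : k ∈ K) :
      ∑ _σ : (Fin d → Fin q) → Bool, ω / 16 ≤ 2 * ∑ σ : (Fin d → Fin q) → Bool, e σ k := by
    calc _ ≤ ∑ σ : (Fin d → Fin q) → Bool, (e σ k + e (Function.update σ k (!σ k)) k) :=
          Finset.sum_le_sum fun σ _ => htwo σ k hk
      _ = _ := by
          rw [Finset.sum_add_distrib, two_mul]
          congr 1
          exact Equiv.sum_comp (hflip k).toPerm fun σ => e σ k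
  obtain ⟨σ, -, hσ⟩ := Finset.exists_le_of_sum_le (s := Finset.univ)
    (f := fun _ : (Fin d → Fin q) → Bool => (K.card : ℝ) * (a * ω / 16))
    (g := fun σ => ∑ k ∈ K, 2 * a * e σ k) Finset.univ_nonempty (by
      rw [Finset.sum_comm]
      calc _ = ∑ k ∈ K, a * ∑ _σ : (Fin d → Fin q) → Bool, ω / 16 := by
            simp only [Finset.sum_const, nsmul_eq_mul]
            ring
        _ ≤ _ := Finset.sum_le_sum fun k hk => by
            rw [← Finset.mul_sum]
            nlinarith [hsum k hk])
  exact ⟨σ, hσ.trans (hexc σ)⟩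

end Hypercube

/-! ### The hypercube of regression functions -/

section Construction

variable {d q : ℕ}

/-- The integer lattice point with the coordinates of `k`. -/
def latticePoint (k : Fin d → Fin q) : Euc d := WithLp.toLp 2 fun i => ((k i : ℕ) : ℝ)

lemma notMem_tsupport_or_notMem_tsupport {u : Euc d → ℝ}
    (hu : tsupport u ⊆ box fun _ => Metric.closedBall (1 / 4) (1 / 3)) {k l : Fin d → Fin q}
    (hkl : k ≠ l) (x : Euc d) :
    x - latticePoint k ∉ tsupport u ∨ x - latticePoint l ∉ tsupport u := by
  by_contra! h
  refine hkl (funext fun i => Fin.ext ?_)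
  have h1 := hu h.1 i
  have h2 := hu h.2 i
  rw [Metric.mem_closedBall, Real.dist_eq, abs_le] at h1 h2
  simp only [latticePoint, PiLp.sub_apply] at h1 h2
  have h3 : ((k i : ℕ) : ℝ) < (l i : ℕ) + 1 := by linarith
  have h4 : ((l i : ℕ) : ℝ) < (k i : ℕ) + 1 := by linarith
  norm_cast at h3 h4
  omega

/-- The regression function whose deviation from `1/2` on the cell `k ∈ K` has the sign
prescribed by `σ k`. -/
def cubeRegression (u : Euc d → ℝ) (a : ℝ) (K : Finset (Fin d → Fin q))
    (σ : (Fin d → Fin q) → Bool) (x : Euc d) : ℝ :=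
  1 / 2 + a * ∑ k ∈ K, (if σ k then 1 else -1) * u ((q : ℝ) • x - latticePoint k)

variable {u : Euc d → ℝ} {a : ℝ} {K : Finset (Fin d → Fin q)} {σ : (Fin d → Fin q) → Bool}

lemma abs_cubeRegression_sub_half_le
    (hu01 : ∀ x, u x ∈ Set.Icc (0 : ℝ) 1)
    (hu : tsupport u ⊆ box fun _ => Metric.closedBall (1 / 4) (1 / 3))
    (ha : 0 ≤ a) (x : Euc d) :
    |cubeRegression u a K σ x - 1 / 2| ≤ a := by
  have := norm_sum_le_of_pairwise_eq_zero (K := K)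
    (f := fun k => (if σ k then 1 else -1) * u ((q : ℝ) • x - latticePoint k)) zero_le_one
    (fun k _ => by
      have := hu01 ((q : ℝ) • x - latticePoint k)
      split_ifs <;> simp [abs_of_nonneg this.1, this.2])
    (fun k l hkl => (notMem_tsupport_or_notMem_tsupport hu hkl ((q : ℝ) • x)).imp
      (fun h => by simp [image_eq_zero_of_notMem_tsupport h])
      (fun h => by simp [image_eq_zero_of_notMem_tsupport h]))
  rw [cubeRegression, add_sub_cancel_left, abs_mul, abs_of_nonneg ha]
  exact mul_le_of_le_one_right ha this

lemma bump_eq_one_of_mem_cell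
    (hu1 : ∀ x : Euc d, (∀ i, x i ∈ Set.Icc (0 : ℝ) (1 / 2)) → u x = 1)
    (hq : 0 < q) {k : Fin d → Fin q} {x : Euc d} (hx : x ∈ cell q k) :
    u ((q : ℝ) • x - latticePoint k) = 1 := by
  have hq' : (0 : ℝ) < q := by exact_mod_cast hq
  refine hu1 _ fun i => ?_
  obtain ⟨h1, h2⟩ := hx i
  simp only [latticePoint, PiLp.sub_apply, PiLp.smul_apply, smul_eq_mul]
  rw [div_le_iff₀' hq'] at h1
  have h3 : (q : ℝ) * x i ≤ (k i : ℕ) + 1 / 2 := by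
    calc (q : ℝ) * x i ≤ q * (((k i : ℕ) : ℝ) / q + 1 / (2 * q)) := by gcongr
      _ = _ := by field_simp
  constructor <;> linarith

lemma bump_eq_zero_of_mem_cell
    (hu1 : ∀ x : Euc d, (∀ i, x i ∈ Set.Icc (0 : ℝ) (1 / 2)) → u x = 1)
    (hu : tsupport u ⊆ box fun _ => Metric.closedBall (1 / 4) (1 / 3))
    (hq : 0 < q) {k l : Fin d → Fin q} (hlk : l ≠ k) {x : Euc d}
    (hx : x ∈ cell q k) : u ((q : ℝ) • x - latticePoint l) = 0 := by
  refine image_eq_zero_of_notMem_tsupport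
    ((notMem_tsupport_or_notMem_tsupport hu hlk _).resolve_right fun h => h ?_)
  refine subset_tsupport u ?_
  rw [Function.mem_support, bump_eq_one_of_mem_cell hu1 hq hx]
  exact one_ne_zero

lemma cubeRegression_of_mem
    (hu1 : ∀ x : Euc d, (∀ i, x i ∈ Set.Icc (0 : ℝ) (1 / 2)) → u x = 1)
    (hu : tsupport u ⊆ box fun _ => Metric.closedBall (1 / 4) (1 / 3))
    (hq : 0 < q) {k : Fin d → Fin q} (hk : k ∈ K) {x : Euc d}
    (hx : x ∈ cell q k) : cubeRegression u a K σ x = 1 / 2 + if σ k then a else -a := by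
  rw [cubeRegression, Finset.sum_eq_single_of_mem k hk fun l _ hl => by
    rw [bump_eq_zero_of_mem_cell hu1 hu hq hl hx, mul_zero], bump_eq_one_of_mem_cell hu1 hq hx]
  split_ifs <;> simp

lemma cubeRegression_of_notMem
    (hu1 : ∀ x : Euc d, (∀ i, x i ∈ Set.Icc (0 : ℝ) (1 / 2)) → u x = 1)
    (hu : tsupport u ⊆ box fun _ => Metric.closedBall (1 / 4) (1 / 3))
    (hq : 0 < q) {k : Fin d → Fin q} (hk : k ∉ K) {x : Euc d}
    (hx : x ∈ cell q k) : cubeRegression u a K σ x = 1 / 2 := by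
  rw [cubeRegression, Finset.sum_eq_zero fun l hl => by
    rw [bump_eq_zero_of_mem_cell hu1 hu hq (ne_of_mem_of_not_mem hl hk) hx, mul_zero]]
  simp

lemma margin_cubeRegression
    (hu1 : ∀ x : Euc d, (∀ i, x i ∈ Set.Icc (0 : ℝ) (1 / 2)) → u x = 1)
    (hu : tsupport u ⊆ box fun _ => Metric.closedBall (1 / 4) (1 / 3))
    (hq : 0 < q) {α C₀ : ℝ} (hα : 0 ≤ α) (ha : 0 < a) (hC₀ : 0 ≤ C₀)
    (hm : K.card * (1 / q : ℝ) ^ d ≤ C₀ * a ^ α) :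
    margin d α C₀ (gridMeasure d q) (cubeRegression u a K σ) := by
  intro t ht
  by_cases hat : a ≤ t
  · calc gridMeasure d q {x | 0 < |cubeRegression u a K σ x - 1 / 2| ∧
          |cubeRegression u a K σ x - 1 / 2| ≤ t}
        ≤ gridMeasure d q (⋃ k ∈ K, cell q k) := by
          refine measure_mono_ae ((ae_mem_grid d q).mono fun x hx h => ?_)
          obtain ⟨k, hk⟩ := mem_grid_iff.1 hx
          refine Set.mem_biUnion (x := k) ?_ hk
          by_contra hkK
          have := h.1
          rw [cubeRegression_of_notMem hu1 hu hq hkK hk] at this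
          simp at this
      _ ≤ ∑ k ∈ K, gridMeasure d q (cell q k) := measure_biUnion_finset_le _ _
      _ = ENNReal.ofReal (K.card * (1 / q : ℝ) ^ d) := by
          rw [ENNReal.ofReal_mul (by positivity), ENNReal.ofReal_natCast]
          simp only [gridMeasure_cell hq, Finset.sum_const, nsmul_eq_mul]
      _ ≤ _ := by
          refine ENNReal.ofReal_le_ofReal (hm.trans ?_)
          gcongr
  · refine (measure_mono_null_ae (t := ∅) ?_ measure_empty).le.trans bot_le
    refine (ae_mem_grid d q).mono fun x hx h => ?_
    obtain ⟨k, hk⟩ := mem_grid_iff.1 hx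
    obtain ⟨h1, h2⟩ := h
    by_cases hkK : k ∈ K
    · refine hat (le_trans (le_of_eq ?_) h2)
      rw [cubeRegression_of_mem hu1 hu hq hkK hk, add_sub_cancel_left]
      split_ifs <;> simp [abs_of_pos ha]
    · rw [cubeRegression_of_notMem hu1 hu hq hkK hk] at h1
      simp at h1

end Construction

/-- Choice of the resolution `q` and the number `m` of perturbed cells for sample size `n`. -/
lemma exists_resolution {d n : ℕ} (hn : 1 ≤ n) {α β : ℝ} (hα : 0 < α) (hβ : 0 < β)
    (hαβ : α * β ≤ d) :
    ∃ q m : ℕ, 0 < q ∧ m ≤ q ^ d ∧ (m : ℝ) * (1 / q : ℝ) ^ d ≤ ((q : ℝ) ^ (-β)) ^ α ∧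
      n * ((q : ℝ) ^ (-β)) ^ 2 * (1 / q : ℝ) ^ d ≤ 1 ∧
      1 / 2 * 2 ^ (-(β * (1 + α))) * (n : ℝ) ^ (-(β * (1 + α) / (2 * β + d))) ≤
        m * ((q : ℝ) ^ (-β) * (1 / q : ℝ) ^ d) := by
  have hs : 0 < 2 * β + d := by positivity
  have hn1 : (1 : ℝ) ≤ n := by exact_mod_cast hn
  set t : ℝ := (n : ℝ) ^ (1 / (2 * β + d)) with ht
  have ht1 : 1 ≤ t := Real.one_le_rpow hn1 (by positivity)
  have htn : t ^ (2 * β + d) = n := by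
    rw [ht, ← Real.rpow_mul (by linarith), one_div, inv_mul_cancel₀ hs.ne', Real.rpow_one]
  set q := ⌈t⌉₊ with hqdef
  have htq : t ≤ q := Nat.le_ceil t
  have hq2 : (q : ℝ) ≤ 2 * t := by linarith [Nat.ceil_lt_add_one (by linarith : 0 ≤ t)]
  have hq1 : (1 : ℝ) ≤ q := ht1.trans htq
  have hq0 : (0 : ℝ) < q := by linarith
  have hqd : (1 / q : ℝ) ^ d = (q : ℝ) ^ (-(d : ℝ)) := by
    rw [one_div, inv_pow, Real.rpow_neg hq0.le, Real.rpow_natCast]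
  set y : ℝ := (q : ℝ) ^ (d - α * β) with hy
  have hy1 : 1 ≤ y := Real.one_le_rpow hq1 (by linarith)
  have hmy : (⌊y⌋₊ : ℝ) ≤ y := Nat.floor_le (by linarith)
  have hm1 : (1 : ℝ) ≤ ⌊y⌋₊ := by exact_mod_cast Nat.le_floor (by simpa using hy1)
  have hym : 1 / 2 * y ≤ ⌊y⌋₊ := by linarith [Nat.lt_floor_add_one y]
  refine ⟨q, ⌊y⌋₊, by exact_mod_cast hq0, ?_, ?_, ?_, ?_⟩
  · have : y ≤ (q : ℝ) ^ d := by
      rw [hy, ← Real.rpow_natCast]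
      exact Real.rpow_le_rpow_of_exponent_le hq1 (by linarith [mul_pos hα hβ])
    exact_mod_cast hmy.trans this
  · calc (⌊y⌋₊ : ℝ) * (1 / q : ℝ) ^ d ≤ y * (1 / q : ℝ) ^ d := by gcongr
      _ = _ := by
        rw [hqd, hy, ← Real.rpow_add hq0, ← Real.rpow_mul hq0.le]
        congr 1
        ring
  · calc n * ((q : ℝ) ^ (-β)) ^ 2 * (1 / q : ℝ) ^ d
        ≤ (q : ℝ) ^ (2 * β + d) * ((q : ℝ) ^ (-β)) ^ 2 * (1 / q : ℝ) ^ d := by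
          rw [← htn]
          gcongr
      _ = 1 := by
        rw [hqd, ← Real.rpow_natCast, ← Real.rpow_mul hq0.le, ← Real.rpow_add hq0,
          ← Real.rpow_add hq0, ← Real.rpow_zero (q : ℝ)]
        congr 1
        push_cast
        ring
  · have hnt : (n : ℝ) ^ (-(β * (1 + α) / (2 * β + d))) = t ^ (-(β * (1 + α))) := by
      rw [ht, ← Real.rpow_mul (by linarith)]
      congr 1
      ring
    calc 1 / 2 * 2 ^ (-(β * (1 + α))) * (n : ℝ) ^ (-(β * (1 + α) / (2 * β + d)))
        = 1 / 2 * (2 * t) ^ (-(β * (1 + α))) := by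
          rw [hnt, Real.mul_rpow two_pos.le (by linarith), mul_assoc]
      _ ≤ 1 / 2 * (q : ℝ) ^ (-(β * (1 + α))) := by
          gcongr 1 / 2 * ?_
          exact Real.rpow_le_rpow_of_nonpos hq0 hq2 (by nlinarith)
      _ = 1 / 2 * y * ((q : ℝ) ^ (-β) * (1 / q : ℝ) ^ d) := by
          rw [hqd, hy, mul_assoc, ← Real.rpow_add hq0, ← Real.rpow_add hq0]
          congr 2
          ring
      _ ≤ _ := by gcongr

lemma holderClass_mono {d : ℕ} {β L L' : ℝ} (h : L ≤ L') : holderClass d β L ⊆ holderClass d β L' :=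
  fun _ hg => ⟨hg.1, fun x x' => (hg.2 x x').trans (by gcongr)⟩

theorem statement3 (d : ℕ) (hd : 1 ≤ d) (L β α : ℝ) (hL : 0 < L) (hβ : 0 < β)
    (hα : 0 < α) (hαβ : α * β ≤ d) :
    ∃ (C₀ c₀ r₀ μmin μmax : ℝ) (𝒞 : Set (Euc d)),
      0 < C₀ ∧ 0 < c₀ ∧ 0 < r₀ ∧ 0 < μmin ∧ μmin < 1 ∧ 1 < μmax ∧ IsCompact 𝒞 ∧
      {x : Euc d | ∀ i, x i ∈ Set.Icc (0:ℝ) 1} ⊆ 𝒞 ∧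
      ∃ C > (0:ℝ), ∀ n : ℕ, 1 ≤ n → ∀ fhat : (Fin n → Euc d × ℝ) → Euc d → Bool,
        Measurable (Function.uncurry fhat) →
        ∃ (PX : Measure (Euc d)) (η : Euc d → ℝ),
          IsProbabilityMeasure PX ∧ Measurable η ∧ (∀ x, η x ∈ Set.Icc (0:ℝ) 1) ∧
          margin d α C₀ PX η ∧ η ∈ holderClass d β L ∧
          strongDensity d c₀ r₀ μmin μmax 𝒞 PX ∧
          C * (n : ℝ) ^ (-(β * (1 + α) / (2 * β + d))) ≤ expectedExcess d n PX η fhat := by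
  obtain ⟨u, huC, huc, hu01, hu1, hus⟩ := exists_cube_bump d
  obtain ⟨M, hM, hholder⟩ := exists_holder_bump_sum hβ (huC _) huc
  set κ : ℝ := min (1 / 4) (L / M) with hκdef
  have hκ : 0 < κ := lt_min (by norm_num) (by positivity)
  have hκ4 : κ ≤ 1 / 4 := min_le_left _ _
  have hκM : κ * M ≤ L := (le_div_iff₀ hM).1 (min_le_right _ _)
  have hd' : (0 : ℝ) < d := by exact_mod_cast hd
  refine ⟨κ ^ (-α), (1 / (8 * d)) ^ d, 1, 1 / 2, 2 ^ d, box fun _ => Set.Icc 0 1, by positivity,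
    by positivity, one_pos, by norm_num, by norm_num, one_lt_pow₀ _root_.one_lt_two (by lia),
    isCompact_box fun _ => isCompact_Icc, subset_rfl,
    κ / 16 * (1 / 2 * 2 ^ (-(β * (1 + α)))), by positivity, fun n hn fhat hf => ?_⟩
  obtain ⟨q, m, hq, hmq, hm, hnq, hrate⟩ := exists_resolution (d := d) hn hα hβ hαβ
  have hq1 : (1 : ℝ) ≤ q := by exact_mod_cast hq
  have hq0 : (0 : ℝ) < q := by exact_mod_cast hq
  obtain ⟨K, -, hK⟩ := Finset.exists_subset_card_eq
    (s := (Finset.univ : Finset (Fin d → Fin q))) (n := m) (by simpa using hmq)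
  set b : ℝ := (q : ℝ) ^ (-β) with hb
  have hb0 : 0 < b := by positivity
  have hb1 : b ≤ 1 := Real.rpow_le_one_of_one_le_of_nonpos hq1 (by linarith)
  have ha : 0 < κ * b := by positivity
  have ha4 : κ * b ≤ 1 / 4 := by nlinarith
  have hη (σ) : cubeRegression u (κ * b) K σ ∈ holderClass d β L :=
    holderClass_mono hκM (hholder _ K latticePoint (fun k => if σ k then 1 else -1) (1 / 2) κ q
      (fun _ _ => notMem_tsupport_or_notMem_tsupport hus) (fun k => by split_ifs <;> simp)
      hκ.le hq0)
  have hηm (σ) : Measurable (cubeRegression u (κ * b) K σ) := (hη σ).1.continuous.measurable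
  have hη01 (σ x) : cubeRegression u (κ * b) K σ x ∈ Set.Icc (0 : ℝ) 1 := by
    have := abs_le.1 (abs_cubeRegression_sub_half_le (K := K) (σ := σ) hu01 hus ha.le x)
    constructor <;> linarith
  have hn4 : n * (4 * (κ * b) ^ 2 * (1 / q : ℝ) ^ d) ≤ 1 / 2 := by
    calc n * (4 * (κ * b) ^ 2 * (1 / q : ℝ) ^ d)
        = 4 * κ ^ 2 * (n * b ^ 2 * (1 / q : ℝ) ^ d) := by ring
      _ ≤ 4 * κ ^ 2 * 1 := by gcongr
      _ ≤ 1 / 2 := by nlinarith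
  obtain ⟨σ, hσ⟩ := exists_le_expectedExcess hq ha (by linarith) hn4 hηm hη01
    (fun σ k hk x hx => cubeRegression_of_mem hu1 hus hq hk hx)
    (fun σ k hk x hx => cubeRegression_of_notMem hu1 hus hq hk hx) hf
  refine ⟨gridMeasure d q, cubeRegression u (κ * b) K σ, isProbabilityMeasure_gridMeasure d hq,
    hηm σ, hη01 σ, margin_cubeRegression hu1 hus hq hα.le ha (by positivity) ?_, hη σ,
    strongDensity_gridMeasure hd q, le_trans ?_ hσ⟩
  · rw [hK, Real.mul_rpow hκ.le hb0.le, ← mul_assoc, ← Real.rpow_add hκ, neg_add_cancel,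
      Real.rpow_zero, one_mul]
    exact hm
  · rw [hK, mul_assoc]
    calc _ ≤ κ / 16 * (m * (b * (1 / q : ℝ) ^ d)) := by gcongr
      _ = _ := by ring
end
end

section
/- If α(1∧β) > 1, then there is no distribution P ∈ 𝒫_Σ such that the regression function η associated with P crosses the level 1/2 at a point in the interior of the support of P_X. (Here η crosses 1/2 at x₀ ∈ ℝ^d if for every r > 0 there exist x₋, x₊ ∈ B(x₀,r) with η(x₋) < 1/2 and η(x₊) > 1/2.) -/
open MeasureTheory ENNReal Matrix
open scoped Classical

noncomputable section

/-- Topological support of a measure: points all of whose neighborhoods have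
positive measure. -/
def measSupport (d : ℕ) (PX : Measure (Euc d)) : Set (Euc d) :=
  {x | ∀ r : ℝ, 0 < r → 0 < PX (Metric.ball x r)}

/-- A Hölder function on `[0,1]` going from a nonpositive value to a value at least `ε` spends a
time at least `(ε / K) ^ (1 / b)` in `(0, ε]`. -/
theorem le_volume_crossing {h : ℝ → ℝ} {K b ε : ℝ} (hK : 0 < K) (hb : 0 < b) (hε : 0 < ε)
    (hcont : ContinuousOn h (Set.Icc 0 1))
    (hhold : ∀ s ∈ Set.Icc (0:ℝ) 1, ∀ t ∈ Set.Icc (0:ℝ) 1, |h t - h s| ≤ K * |t - s| ^ b)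
    (h0 : h 0 ≤ 0) (h1 : ε ≤ h 1) :
    ENNReal.ofReal ((ε / K) ^ (1 / b)) ≤
      volume {s | s ∈ Set.Icc (0:ℝ) 1 ∧ 0 < h s ∧ h s ≤ ε} := by
  obtain ⟨t, ⟨htI, ht⟩, htmin⟩ :=
    (isCompact_Icc.of_isClosed_subset
      (hcont.preimage_isClosed_of_isClosed isClosed_Icc isClosed_Ici)
      Set.inter_subset_left : IsCompact (Set.Icc (0:ℝ) 1 ∩ h ⁻¹' Set.Ici ε)).exists_isLeast
      ⟨1, ⟨zero_le_one, le_rfl⟩, h1⟩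
  have hsub : Set.Icc 0 t ⊆ Set.Icc (0:ℝ) 1 := Set.Icc_subset_Icc_right htI.2
  obtain ⟨s, ⟨hsI, hs⟩, hsmax⟩ :=
    (isCompact_Icc.of_isClosed_subset
      ((hcont.mono hsub).preimage_isClosed_of_isClosed isClosed_Icc isClosed_Iic)
      Set.inter_subset_left : IsCompact (Set.Icc (0:ℝ) t ∩ h ⁻¹' Set.Iic 0)).exists_isGreatest
      ⟨0, ⟨le_rfl, htI.1⟩, h0⟩
  simp only [Set.mem_preimage, Set.mem_Ici, Set.mem_Iic] at ht hs
  have hst : 0 ≤ t - s := sub_nonneg.2 hsI.2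
  have hlen : (ε / K) ^ (1 / b) ≤ t - s := by
    have hεK : ε / K ≤ (t - s) ^ b := by
      have := (le_abs_self _).trans (hhold s (hsub hsI) t htI)
      rw [abs_of_nonneg hst] at this
      rw [div_le_iff₀' hK]
      linarith
    calc (ε / K) ^ (1 / b) ≤ ((t - s) ^ b) ^ (1 / b) :=
          Real.rpow_le_rpow (by positivity) hεK (by positivity)
      _ = t - s := by rw [← Real.rpow_mul hst, mul_one_div_cancel hb.ne', Real.rpow_one]
  calc ENNReal.ofReal ((ε / K) ^ (1 / b)) ≤ ENNReal.ofReal (t - s) := ENNReal.ofReal_le_ofReal hlen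
    _ = volume (Set.Ioo s t) := Real.volume_Ioo.symm
    _ ≤ _ := by
      refine measure_mono fun u hu => ?_
      have huI : u ∈ Set.Icc (0:ℝ) 1 := ⟨hsI.1.trans hu.1.le, hu.2.le.trans htI.2⟩
      refine ⟨huI, ?_, ?_⟩
      · by_contra! hneg
        exact absurd (hsmax ⟨⟨huI.1, hu.2.le⟩, hneg⟩) (not_le.2 hu.1)
      · by_contra! hgt
        exact absurd (htmin ⟨huI, hgt.le⟩) (not_le.2 hu.2)

/-- If every segment from `y + v` to `y + v + w`, with `v ∈ U`, spends a proportion at least `c`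
of its time in `S`, then `c * μ U ≤ μ S`. -/
theorem mul_measure_le_of_segments {E : Type*} [NormedAddCommGroup E] [NormedSpace ℝ E]
    [SecondCountableTopology E] [MeasurableSpace E] [BorelSpace E]
    (μ : Measure E) [SFinite μ] [μ.IsAddLeftInvariant]
    {S U : Set E} (hS : MeasurableSet S) (y w : E) {c : ℝ≥0∞}
    (hc : ∀ v ∈ U, c ≤ volume {s | s ∈ Set.Icc (0:ℝ) 1 ∧ y + v + s • w ∈ S}) :
    c * μ U ≤ μ S := by
  set T : Set (E × ℝ) := {p | y + p.1 + p.2 • w ∈ S}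
  have hT : MeasurableSet T :=
    (by fun_prop : Continuous fun p : E × ℝ => y + p.1 + p.2 • w).measurable hS
  calc c * μ U ≤ c * μ {v | c ≤ volume.restrict (Set.Icc (0:ℝ) 1) (Prod.mk v ⁻¹' T)} := by
        gcongr
        intro v hv
        refine (hc v hv).trans_eq ?_
        rw [Measure.restrict_apply (measurable_prodMk_left hT), Set.inter_comm]
        rfl
    _ ≤ ∫⁻ v, volume.restrict (Set.Icc (0:ℝ) 1) (Prod.mk v ⁻¹' T) ∂μ :=
        mul_meas_ge_le_lintegral (measurable_measure_prodMk_left hT) c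
    _ = ∫⁻ s in Set.Icc (0:ℝ) 1, μ ((fun v => (v, s)) ⁻¹' T) := by
        rw [← Measure.prod_apply hT, Measure.prod_apply_symm hT]
    _ = ∫⁻ _ in Set.Icc (0:ℝ) 1, μ S := by
        refine lintegral_congr fun s => ?_
        rw [← measure_preimage_add μ (y + s • w) S]
        congr 1
        ext v
        simp only [T, Set.mem_preimage, Set.mem_ofPred_eq, add_right_comm y v]
    _ = μ S := by simp

/-- Members of a Hölder class are locally Hölder of exponent `min 1 β`. -/
theorem exists_local_holder_of_mem_holderClass {d : ℕ} {β L : ℝ} (hL : 0 < L)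
    {g : Euc d → ℝ} (hg : g ∈ holderClass d β L) (x₀ : Euc d) :
    ∃ K > 0, ∃ r > 0, ∀ x ∈ Metric.ball x₀ r, ∀ y ∈ Metric.ball x₀ r,
      |g y - g x| ≤ K * ‖y - x‖ ^ min 1 β := by
  rcases le_or_gt β 1 with hβ1 | hβ1
  · refine ⟨L, hL, 1, one_pos, fun x _ y _ => ?_⟩
    have hk : ⌈β⌉₊ - 1 = 0 := Nat.sub_eq_zero_of_le (Nat.ceil_le.2 (by simpa using hβ1))
    simpa [hk, taylorPoly, min_eq_right hβ1] using hg.2 x y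
  · have hk : 1 ≤ ⌈β⌉₊ - 1 := by
      have : 1 < ⌈β⌉₊ := Nat.lt_ceil.2 (by simpa using hβ1)
      omega
    have hC1 : ContDiff ℝ 1 g := hg.1.of_le (by exact_mod_cast hk)
    obtain ⟨K, V, hV, hlip⟩ := hC1.contDiffAt (x := x₀) |>.exists_lipschitzOnWith
    obtain ⟨r, hr, hrV⟩ := Metric.mem_nhds_iff.1 hV
    refine ⟨K + 1, by positivity, r, hr, fun x hx y hy => ?_⟩
    have h := hlip.dist_le_mul y (hrV hy) x (hrV hx)
    rw [Real.dist_eq, dist_eq_norm] at h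
    rw [min_eq_left hβ1.le, Real.rpow_one]
    exact h.trans (by gcongr; simp)

/-- Under the strong density assumption, `P_X` dominates `μmin` times Lebesgue measure on the
support of `P_X`. -/
theorem le_measure_of_subset_measSupport {d : ℕ} {c₀ r₀ μmin μmax : ℝ} {𝒞 : Set (Euc d)}
    {PX : Measure (Euc d)} (hdens : strongDensity d c₀ r₀ μmin μmax 𝒞 PX)
    {S : Set (Euc d)} (hS : MeasurableSet S) (hsupp : S ⊆ measSupport d PX) :
    ENNReal.ofReal μmin * volume S ≤ PX S := by
  obtain ⟨A, hA, -, -, f, hfA, hfAc, rfl⟩ := hdens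
  have hSA : S ⊆ A := by
    intro x hx
    by_contra hxA
    obtain ⟨r, hr, hrA⟩ := Metric.isOpen_iff.1 hA.isClosed.isOpen_compl x hxA
    refine (hsupp hx r hr).ne' ?_
    rw [withDensity_apply _ measurableSet_ball,
      setLIntegral_congr_fun (g := fun _ => 0) measurableSet_ball
        fun y hy => by simp [hfAc y (hrA hy)]]
    simp
  rw [withDensity_apply _ hS, ← setLIntegral_const]
  exact setLIntegral_mono' hS fun x hx => ENNReal.ofReal_le_ofReal (hfA x (hSA hx)).1

/-- A lower bound of order `ε ^ p` and an upper bound of order `ε ^ α` are incompatible as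
`ε → 0` when `p < α`. -/
theorem not_forall_mul_rpow_le {D C p α ε₀ : ℝ} (hD : 0 < D) (hp : p < α) (hε₀ : 0 < ε₀) :
    ¬ ∀ ε, 0 < ε → ε ≤ ε₀ → D * ε ^ p ≤ C * ε ^ α := by
  intro h
  have hlim : Filter.Tendsto (fun ε : ℝ => C * ε ^ (α - p)) (nhdsWithin 0 (Set.Ioi 0))
      (nhds 0) := by
    have := ((Real.continuousAt_rpow_const 0 (α - p) (Or.inr (sub_pos.2 hp).le)).const_mul
      C).tendsto
    rw [Real.zero_rpow (sub_pos.2 hp).ne', mul_zero] at this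
    exact this.mono_left nhdsWithin_le_nhds
  refine hD.not_ge (ge_of_tendsto hlim ?_)
  filter_upwards [Ioc_mem_nhdsGT hε₀] with ε hε
  have hpos : 0 < ε ^ p := Real.rpow_pos_of_pos hε.1 p
  rw [Real.rpow_sub hε.1, ← mul_div_assoc, le_div_iff₀ hpos]
  exact h ε hε.1 hε.2

/-- If a continuous function which is Hölder on a ball takes a negative and a positive value there,
then the volume of the part of the ball where it lies in `(0, ε]` is at least of order
`ε ^ (1 / b)`. -/
theorem exists_mul_rpow_le_volume {d : ℕ} {g : Euc d → ℝ} {x₀ : Euc d} {r K b : ℝ}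
    (hK : 0 < K) (hb : 0 < b) (hg : Continuous g)
    (hhold : ∀ x ∈ Metric.ball x₀ r, ∀ y ∈ Metric.ball x₀ r, |g y - g x| ≤ K * ‖y - x‖ ^ b)
    {y z : Euc d} (hy : y ∈ Metric.ball x₀ r) (hz : z ∈ Metric.ball x₀ r)
    (hgy : g y < 0) (hgz : 0 < g z) :
    ∃ D > 0, ∃ ε₀ > 0, ∀ ε, 0 < ε → ε ≤ ε₀ →
      ENNReal.ofReal (D * ε ^ (1 / b)) ≤
        volume {x | x ∈ Metric.ball x₀ r ∧ 0 < g x ∧ g x ≤ ε} := by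
  set w := z - y with hw
  have hwpos : 0 < ‖w‖ := by
    refine norm_pos_iff.2 fun h => ?_
    rw [sub_eq_zero.1 h] at hgz
    exact lt_asymm hgy hgz
  have hcy : Continuous fun v : Euc d => y + v := by fun_prop
  have hcz : Continuous fun v : Euc d => y + v + w := by fun_prop
  have hnhds : ∀ᶠ v in nhds (0 : Euc d), y + v ∈ Metric.ball x₀ r ∧
      y + v + w ∈ Metric.ball x₀ r ∧ g (y + v) < 0 ∧ g z / 2 < g (y + v + w) := by
    have h0y : y + 0 = y := add_zero y
    have h0z : y + 0 + w = z := by rw [h0y, hw, add_sub_cancel]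
    exact (hcy.continuousAt.eventually_mem (Metric.isOpen_ball.mem_nhds (by rwa [h0y]))).and <|
      (hcz.continuousAt.eventually_mem (Metric.isOpen_ball.mem_nhds (by rwa [h0z]))).and <|
      ((hg.comp hcy).continuousAt.eventually_lt_const (by simpa only [Function.comp, h0y])).and <|
      (hg.comp hcz).continuousAt.eventually_const_lt
        (by simpa only [Function.comp, h0z] using half_lt_self hgz)
  obtain ⟨δ, hδ, hU⟩ := Metric.eventually_nhds_iff_ball.1 hnhds
  have hfin : volume (Metric.ball (0 : Euc d) δ) ≠ ∞ := measure_ball_lt_top.ne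
  have hVpos : 0 < (volume (Metric.ball (0 : Euc d) δ)).toReal :=
    ENNReal.toReal_pos (Metric.measure_ball_pos volume 0 hδ).ne' hfin
  set M := K * ‖w‖ ^ b with hM
  have hMpos : 0 < M := by positivity
  refine ⟨(1 / M) ^ (1 / b) * (volume (Metric.ball (0 : Euc d) δ)).toReal, by positivity,
    g z / 2, by positivity, fun ε hε hεz => ?_⟩
  have hS : MeasurableSet {x | x ∈ Metric.ball x₀ r ∧ 0 < g x ∧ g x ≤ ε} :=
    measurableSet_ball.inter <| (measurableSet_lt measurable_const hg.measurable).inter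
      (measurableSet_le hg.measurable measurable_const)
  have hprod : ENNReal.ofReal
      ((1 / M) ^ (1 / b) * (volume (Metric.ball (0 : Euc d) δ)).toReal * ε ^ (1 / b)) =
      ENNReal.ofReal ((ε / M) ^ (1 / b)) * volume (Metric.ball (0 : Euc d) δ) := by
    rw [mul_right_comm, ← Real.mul_rpow (by positivity) hε.le, one_div_mul_eq_div,
      ENNReal.ofReal_mul (by positivity), ENNReal.ofReal_toReal hfin]
  rw [hprod]
  refine mul_measure_le_of_segments volume hS y w fun v hv => ?_
  obtain ⟨hv0, hv1, hgv0, hgv1⟩ := hU v hv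
  have hseg : ∀ s ∈ Set.Icc (0:ℝ) 1, y + v + s • w ∈ Metric.ball x₀ r := fun s hs =>
    (convex_ball x₀ r).add_smul_mem hv0 hv1 hs
  refine (le_volume_crossing (h := fun s => g (y + v + s • w)) hMpos hb hε
    (by fun_prop) (fun s hs t ht => ?_) (by simpa using hgv0.le)
    (by simpa using hεz.trans hgv1.le)).trans (measure_mono fun s hs => ⟨hs.1, hseg s hs.1, hs.2⟩)
  have h := hhold _ (hseg s hs) _ (hseg t ht)
  rw [add_sub_add_left_eq_sub, ← sub_smul, norm_smul, Real.norm_eq_abs,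
    Real.mul_rpow (abs_nonneg _) (norm_nonneg _)] at h
  exact h.trans_eq (by rw [hM]; ring)

theorem statement8 (d : ℕ) (hd : 1 ≤ d) (α C₀ β L c₀ r₀ μmin μmax : ℝ)
    (hα : 0 ≤ α) (hC₀ : 0 < C₀) (hβ : 0 < β) (hL : 0 < L) (hc₀ : 0 < c₀) (hr₀ : 0 < r₀)
    (hμmin : 0 < μmin) (hμ : μmin < μmax) (𝒞 : Set (Euc d)) (h𝒞 : IsCompact 𝒞)
    (hcond : 1 < α * min 1 β)
    (PX : Measure (Euc d)) (η : Euc d → ℝ) (hprob : IsProbabilityMeasure PX)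
    (hmeas : Measurable η) (hrange : ∀ x, η x ∈ Set.Icc (0:ℝ) 1)
    (hMA : margin d α C₀ PX η) (hhold : η ∈ holderClass d β L)
    (hdens : strongDensity d c₀ r₀ μmin μmax 𝒞 PX)
    (x₀ : Euc d)
    (hcross : ∀ r : ℝ, 0 < r →
      (∃ xm ∈ Metric.closedBall x₀ r, η xm < 1/2) ∧
      (∃ xp ∈ Metric.closedBall x₀ r, 1/2 < η xp)) :
    x₀ ∉ interior (measSupport d PX) := by
  intro hx₀
  obtain ⟨ρ, hρ, hρsupp⟩ := Metric.isOpen_iff.1 isOpen_interior x₀ hx₀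
  obtain ⟨K, hK, R, hR, hloc⟩ := exists_local_holder_of_mem_holderClass hL hhold x₀
  have hb : 0 < min 1 β := lt_min one_pos hβ
  set r := min ρ R
  have hr : 0 < r := lt_min hρ hR
  have hsubR : Metric.ball x₀ r ⊆ Metric.ball x₀ R := Metric.ball_subset_ball (min_le_right _ _)
  have hhalf : Metric.closedBall x₀ (r / 2) ⊆ Metric.ball x₀ r :=
    Metric.closedBall_subset_ball (by linarith)
  obtain ⟨⟨y, hy, hηy⟩, z, hz, hηz⟩ := hcross (r / 2) (by positivity)
  have hcont : Continuous fun x => η x - 1 / 2 := hhold.1.continuous.sub continuous_const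
  obtain ⟨D, hD, ε₀, hε₀, hlow⟩ := exists_mul_rpow_le_volume hK hb hcont
    (fun x hx x' hx' => by simpa using hloc x (hsubR hx) x' (hsubR hx'))
    (hhalf hy) (hhalf hz) (sub_neg.2 hηy) (sub_pos.2 hηz)
  have hexp : 1 / min 1 β < α := by rwa [div_lt_iff₀ hb]
  refine not_forall_mul_rpow_le (C := C₀) (mul_pos hμmin hD) hexp hε₀ fun ε hε hεε₀ => ?_
  have hS : MeasurableSet {x | x ∈ Metric.ball x₀ r ∧ 0 < η x - 1 / 2 ∧ η x - 1 / 2 ≤ ε} :=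
    measurableSet_ball.inter <| (measurableSet_lt measurable_const hcont.measurable).inter
      (measurableSet_le hcont.measurable measurable_const)
  rw [← ENNReal.ofReal_le_ofReal_iff (by positivity), mul_assoc, ENNReal.ofReal_mul hμmin.le]
  calc ENNReal.ofReal μmin * ENNReal.ofReal (D * ε ^ (1 / min 1 β))
      ≤ ENNReal.ofReal μmin *
          volume {x | x ∈ Metric.ball x₀ r ∧ 0 < η x - 1 / 2 ∧ η x - 1 / 2 ≤ ε} := by
        gcongr
        exact hlow ε hε hεε₀
    _ ≤ PX {x | x ∈ Metric.ball x₀ r ∧ 0 < η x - 1 / 2 ∧ η x - 1 / 2 ≤ ε} :=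
        le_measure_of_subset_measSupport hdens hS fun x hx =>
          interior_subset (hρsupp (Metric.ball_subset_ball (min_le_left _ _) hx.1))
    _ ≤ PX {x | 0 < |η x - 1/2| ∧ |η x - 1/2| ≤ ε} :=
        measure_mono fun x ⟨_, hpos, hle⟩ => ⟨abs_pos.2 hpos.ne', (abs_of_pos hpos).trans_le hle⟩
    _ ≤ ENNReal.ofReal (C₀ * ε ^ α) := hMA ε hε
end
end
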